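/- Let F : W → ℝ be a class function that is continuous with respect to the L¹ norm and (N+1) times Gâteaux differentiable for some integer N ≥ 0. Then d^{N+1}F(f; g₁, …, g_{N+1}) = 0 for all f ∈ W and all g₁, …, g_{N+1} ∈ Adm(f) if and only if there exist constants a_H, indexed by the isomorphism classes H of multigraphs with at most N edges and no isolated vertices, such that F(f) = Σ_H a_H·t(H,f) for all f ∈ W; moreover these constants a_H are unique. If in addition F is continuous with respect to the cut norm, then a_H = 0 for every H that is not a simple graph. -/

import Mathlib

open MeasureTheory Filter Set Topology
open scoped BigOperators Classical ENNReal

noncomputable section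

/-- The type of kernels: functions `[0,1]² → ℝ` (formalized as functions on all of `ℝ²`). -/
abbrev Kern : Type := ℝ → ℝ → ℝ

/-- Lebesgue measure restricted to `[0,1]`. -/
abbrev μ01 : Measure ℝ := volume.restrict (Set.Icc 0 1)

/-- Symmetric measurable function. -/
def IsSymmMeas (f : Kern) : Prop :=
  Measurable (Function.uncurry f) ∧ ∀ x y, f x y = f y x

/-- Membership in the space `𝒲` of bounded symmetric measurable functions. -/
def IsKernel (f : Kern) : Prop := IsSymmMeas f ∧ ∃ C : ℝ, ∀ x y, |f x y| ≤ C

/-- A graphon: a symmetric measurable function with values in `[0,1]`. -/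
def IsGraphon (f : Kern) : Prop := IsSymmMeas f ∧ ∀ x y, f x y ∈ Set.Icc (0:ℝ) 1

/-- The set `W` of graphons. -/
def Graphons : Set Kern := {f | IsGraphon f}

/-- A multigraph (no loops, multiple edges allowed), with vertex set `Fin nv` and
edge (multi)set indexed by `Fin ne`, the edge `e` having endpoints `s e`, `t e`. -/
structure MG where
  nv : ℕ
  ne : ℕ
  s : Fin ne → Fin nv
  t : Fin ne → Fin nv
  noLoop : ∀ e, s e ≠ t e

/-- The homomorphism density `t(G, f)` of a multigraph `G` in a kernel `f`. -/
def homDensity (G : MG) (f : Kern) : ℝ :=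
  ∫ x : Fin G.nv → ℝ, ∏ e : Fin G.ne, f (x (G.s e)) (x (G.t e))
    ∂(Measure.pi fun _ => μ01)

/-- A node-and-edge homomorphism of multigraphs. -/
structure MGHom (G H : MG) where
  vMap : Fin G.nv → Fin H.nv
  eMap : Fin G.ne → Fin H.ne
  compat : ∀ e, ({H.s (eMap e), H.t (eMap e)} : Finset (Fin H.nv))
      = {vMap (G.s e), vMap (G.t e)}

/-- A surjective node-and-edge homomorphism. -/
def MGHom.Surj {G H : MG} (φ : MGHom G H) : Prop :=
  Function.Surjective φ.vMap ∧ Function.Surjective φ.eMap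

/-- A bijective node-and-edge homomorphism. -/
def MGHom.Bij {G H : MG} (φ : MGHom G H) : Prop :=
  Function.Bijective φ.vMap ∧ Function.Bijective φ.eMap

instance (G H : MG) : Finite (MGHom G H) := by
  have hinj : Function.Injective (fun φ : MGHom G H => (φ.vMap, φ.eMap)) := by
    rintro ⟨v1, e1, h1⟩ ⟨v2, e2, h2⟩ h
    simp only [Prod.mk.injEq] at h
    obtain ⟨hv, he⟩ := h
    subst hv; subst he; rfl
  exact Finite.of_injective _ hinj

/-- Isomorphism of multigraphs. -/
def MGIso (G H : MG) : Prop := ∃ φ : MGHom G H, φ.Bij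

/-- A multigraph with no isolated vertices. -/
def NoIsolated (G : MG) : Prop := ∀ v, ∃ e, G.s e = v ∨ G.t e = v

/-- A multigraph is simple if no two (distinct) edges have the same pair of endpoints. -/
def IsSimpleMG (G : MG) : Prop :=
  ∀ e e', ({G.s e, G.t e} : Finset (Fin G.nv)) = ({G.s e', G.t e'} : Finset (Fin G.nv))
    → e = e'

/-- A class function on graphon space: it only depends on the homomorphism densities
with respect to finite simple graphs. -/
def IsClassFun (F : Kern → ℝ) : Prop :=
  ∀ f g, IsGraphon f → IsGraphon g →
    (∀ G : MG, IsSimpleMG G → homDensity G f = homDensity G g) → F f = F g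

/-- The `L¹` distance between two kernels (on the square `[0,1]²`). -/
def l1Dist (f g : Kern) : ℝ := ∫ x, ∫ y, |f x y - g x y| ∂μ01 ∂μ01

/-- Continuity on the set of graphons with respect to the `L¹` norm. -/
def L1ContOn (F : Kern → ℝ) : Prop :=
  ∀ f ∈ Graphons, ∀ ε : ℝ, 0 < ε → ∃ δ : ℝ, 0 < δ ∧
    ∀ g ∈ Graphons, l1Dist f g < δ → |F f - F g| < ε

/-- The cut norm of a kernel. -/
def cutNorm (f : Kern) : ℝ :=
  sSup {r : ℝ | ∃ S T : Set ℝ, MeasurableSet S ∧ MeasurableSet T ∧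
    S ⊆ Set.Icc 0 1 ∧ T ⊆ Set.Icc 0 1 ∧ r = |∫ x in S, ∫ y in T, f x y|}

/-- Continuity on the set of graphons with respect to the cut norm. -/
def CutContOn (F : Kern → ℝ) : Prop :=
  ∀ f ∈ Graphons, ∀ ε : ℝ, 0 < ε → ∃ δ : ℝ, 0 < δ ∧
    ∀ g ∈ Graphons, cutNorm (f - g) < δ → |F f - F g| < ε

section Gateaux

variable {E : Type*} [AddCommGroup E] [Module ℝ E]

/-- Admissible directions at `f` for a convex subset `U` of a real vector space:
directions `g` so that `f + ε g ∈ U` for all sufficiently small `ε ∈ [0,1)`. -/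
def adm (U : Set E) (f : E) : Set E :=
  {g | ∃ ε₀ : ℝ, 0 < ε₀ ∧ ε₀ ≤ 1 ∧ ∀ ε : ℝ, 0 ≤ ε → ε < ε₀ → f + ε • g ∈ U}

/-- Iterated mixed Gâteaux derivative `d^n F(f; g₁, …, g_n)` of `F : U → ℝ`, computed
through one-sided difference quotients restricted to `U`; the derivative in the last
direction is taken first.  (The value is given by `Filter.limUnder`, i.e. it is the
limit of the difference quotients whenever this limit exists.) -/
def gD (U : Set E) (F : E → ℝ) : (n : ℕ) → E → (Fin n → E) → ℝ
  | 0 => fun f _ => F f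
  | n + 1 => fun f g =>
      limUnder (nhdsWithin (0:ℝ) {t : ℝ | t ≠ 0 ∧ f + t • g (Fin.last n) ∈ U})
        (fun t => (gD U F n (f + t • g (Fin.last n)) (fun i => g i.castSucc)
              - gD U F n f (fun i => g i.castSucc)) / t)

/-- `F` is `n` times Gâteaux differentiable on `U`: all iterated Gâteaux derivatives
up to order `n` in admissible directions exist (i.e. the corresponding difference
quotients genuinely converge). -/
def GDiffN (U : Set E) (F : E → ℝ) : ℕ → Prop
  | 0 => True
  | n + 1 => GDiffN U F n ∧
      ∀ f ∈ U, ∀ g : Fin (n+1) → E, (∀ i, g i ∈ adm U f) →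
        Tendsto
          (fun t : ℝ => (gD U F n (f + t • g (Fin.last n)) (fun i => g i.castSucc)
              - gD U F n f (fun i => g i.castSucc)) / t)
          (nhdsWithin (0:ℝ) {t : ℝ | t ≠ 0 ∧ f + t • g (Fin.last n) ∈ U})
          (nhds (gD U F (n+1) f g))

/-- `F : U → ℝ` is `C^n` at `f`: for any admissible directions `g₁, …, g_m`, the map
`(λ₁, …, λ_m) ↦ F(f + Σᵢ λᵢ gᵢ)` admits a `C^n` extension to all of `ℝ^m`. -/
def IsCnAt (U : Set E) (F : E → ℝ) (n : ℕ) (f : E) : Prop :=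
  ∀ (m : ℕ) (g : Fin m → E), (∀ i, g i ∈ adm U f) →
    ∃ G : (Fin m → ℝ) → ℝ, ContDiff ℝ n G ∧
      ∀ lam : Fin m → ℝ, f + ∑ i, lam i • g i ∈ U → G lam = F (f + ∑ i, lam i • g i)

/-- `F` is `C^n` (everywhere on `U`). -/
def IsCn (U : Set E) (F : E → ℝ) (n : ℕ) : Prop := ∀ f ∈ U, IsCnAt U F n f

/-- `F` is Gâteaux smooth: `C^n` at every point for every `n`. -/
def GSmooth (U : Set E) (F : E → ℝ) : Prop := ∀ n : ℕ, IsCn U F n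

end Gateaux

/-- Iso-invariance of a family of constants indexed by multigraphs. -/
def IsoInvariant (a : MG → ℝ) : Prop := ∀ G H, MGIso G H → a G = a H

/-- Coefficients indexed by the isomorphism classes of multigraphs with at most `N`
edges and no isolated vertices (encoded as iso-invariant families of constants
vanishing outside this class of multigraphs). -/
def GoodCoeffs (N : ℕ) (a : MG → ℝ) : Prop :=
  IsoInvariant a ∧ ∀ G : MG, ¬(G.ne ≤ N ∧ NoIsolated G) → a G = 0

/-- A functional on `W^n` is multilinear if its restriction to tuples from the
subspace `𝒲` (= span of `W`) is linear in each coordinate. -/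
def MultilinearOnKerns (n : ℕ) (Λ : (Fin n → Kern) → ℝ) : Prop :=
  (∀ (g : Fin n → Kern), (∀ j, IsKernel (g j)) → ∀ (i : Fin n) (u v : Kern),
      IsKernel u → IsKernel v →
      Λ (Function.update g i (u + v))
        = Λ (Function.update g i u) + Λ (Function.update g i v)) ∧
  (∀ (g : Fin n → Kern), (∀ j, IsKernel (g j)) → ∀ (i : Fin n) (c : ℝ) (u : Kern),
      IsKernel u →
      Λ (Function.update g i (c • u)) = c * Λ (Function.update g i u))

/-- A functional on `W^n` extends to a multilinear functional on `(span ℝ W)^n`. -/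
def IsMultilinearOnW (n : ℕ) (Λ : (Fin n → Kern) → ℝ) : Prop :=
  ∃ L : MultilinearMap ℝ (fun _ : Fin n => ↥(Submodule.span ℝ Graphons)) ℝ,
    ∀ (g : Fin n → Kern) (h : ∀ i, g i ∈ Graphons),
      L (fun i => ⟨g i, Submodule.subset_span (h i)⟩) = Λ g

/-- An invertible Lebesgue-measure-preserving bijection of `[0,1]`. -/
def IsMPB (σ : ℝ → ℝ) : Prop :=
  MeasurePreserving σ μ01 μ01 ∧ Set.BijOn σ (Set.Icc 0 1) (Set.Icc 0 1)

/-- The action `f ↦ f^σ` of maps of `[0,1]` on kernels. -/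
def Kern.translate (σ : ℝ → ℝ) (f : Kern) : Kern := fun x y => f (σ x) (σ y)

/-- The cell `((a)/p, (a+1)/p]` of the regular partition of `[0,1]` (`a = 0, …, p-1`). -/
def cell (p : ℕ) (a : Fin p) : Set ℝ :=
  Set.Ioc (((a : ℕ) : ℝ) / (p : ℝ)) ((((a : ℕ) : ℝ) + 1) / (p : ℝ))

/-- The basic step graphon `e^p_(a,b)`: symmetrized indicator of `cell a × cell b`. -/
def ep (p : ℕ) (a b : Fin p) : Kern := fun x y =>
  if (x ∈ cell p a ∧ y ∈ cell p b) ∨ (x ∈ cell p b ∧ y ∈ cell p a) then 1 else 0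

/-- The step kernel with values `c a b` on the cell `cell a × cell b` (`a ≠ b`) and `0`
on the diagonal cells and outside `(0,1]²`. -/
def stepFn (p : ℕ) (c : Fin p → Fin p → ℝ) : Kern := fun x y =>
  ∑ a : Fin p, ∑ b : Fin p, if a ≠ b ∧ x ∈ cell p a ∧ y ∈ cell p b then c a b else 0

/-- The set `W_𝐩 = ⋃ₚ W_p` of step graphons. -/
def StepGraphons : Set Kern := {f | IsGraphon f ∧ ∃ p c, f = stepFn p c}

/-- The union of the `S_[0,1]`-translates of `W_𝐩`. -/
def StepTranslates : Set Kern :=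
  {f | ∃ σ : ℝ → ℝ, IsMPB σ ∧ ∃ g ∈ StepGraphons, f = Kern.translate σ g}

/-- Add `m` isolated vertices to a multigraph. -/
def MG.pad (G : MG) (m : ℕ) : MG where
  nv := G.nv + m
  ne := G.ne
  s := fun e => Fin.castAdd m (G.s e)
  t := fun e => Fin.castAdd m (G.t e)
  noLoop := fun e h => G.noLoop e (by
    apply Fin.ext
    simpa using congrArg Fin.val h)

/-- Two multigraphs become isomorphic after deleting isolated vertices (equivalently,
after adding enough isolated vertices). -/
def StripEquiv (G H : MG) : Prop := ∃ a b : ℕ, MGIso (G.pad a) (H.pad b)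

/-- A tuple of pairs of distinct indices in `Fin p` (encoding a tuple in `E_p^n`). -/
def ValidTuple (p n : ℕ) (x : Fin n → Fin p × Fin p) : Prop := ∀ l, (x l).1 ≠ (x l).2

/-- The multigraph `Γ_{n,p}(x)` associated to a tuple `x ∈ E_p^n`. -/
def tupleMG (p n : ℕ) (x : Fin n → Fin p × Fin p) (hx : ValidTuple p n x) : MG :=
  ⟨p, n, fun l => (x l).1, fun l => (x l).2, hx⟩

/-- Symmetry of a functional on `W^n` under permutation of arguments. -/
def SymmFunc (n : ℕ) (Λ : (Fin n → Kern) → ℝ) : Prop :=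
  ∀ (g : Fin n → Kern), (∀ i, g i ∈ Graphons) → ∀ τ : Equiv.Perm (Fin n),
    Λ (g ∘ τ) = Λ g

/-- `S_[0,1]`-invariance of a functional on `W^n`. -/
def SInvFunc (n : ℕ) (Λ : (Fin n → Kern) → ℝ) : Prop :=
  ∀ (g : Fin n → Kern), (∀ i, g i ∈ Graphons) → ∀ σ : ℝ → ℝ, IsMPB σ →
    Λ (fun i => Kern.translate σ (g i)) = Λ g

/-- `π` is the consistency-constraint matrix `π_{n,k}`: it is invariant under
isomorphism-after-deleting-isolated-vertices in both arguments, and for every `p ≥ 2`,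
every symmetric `S_[0,1]`-invariant multilinear functional `Λ : W^n → ℝ`, every
`x ∈ E_p^n` and every complete system `y` of pairwise non-isomorphic representatives
of the multigraphs with `n` edges on `kp` vertices, one has
`C_{n,p}(Λ)(Γ(x)) = Σ_h π(Γ(x)∼, h∼) C_{n,kp}(Λ)(h)`. -/
def ConsistencyMatrix (n k : ℕ) (π : MG → MG → ℕ) : Prop :=
  (∀ G G' H H', StripEquiv G G' → StripEquiv H H' → π G H = π G' H') ∧
  ∀ p : ℕ, 2 ≤ p → ∀ Λ : (Fin n → Kern) → ℝ,
    SymmFunc n Λ → SInvFunc n Λ → MultilinearOnKerns n Λ →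
    ∀ (x : Fin n → Fin p × Fin p) (hx : ValidTuple p n x),
    ∀ (m : ℕ) (y : Fin m → Fin n → Fin (k*p) × Fin (k*p))
      (hy : ∀ i, ValidTuple (k*p) n (y i)),
      (∀ i j, i ≠ j →
        ¬ MGIso (tupleMG (k*p) n (y i) (hy i)) (tupleMG (k*p) n (y j) (hy j))) →
      (∀ (z : Fin n → Fin (k*p) × Fin (k*p)) (hz : ValidTuple (k*p) n z),
        ∃ i, MGIso (tupleMG (k*p) n z hz) (tupleMG (k*p) n (y i) (hy i))) →
      Λ (fun l => ep p (x l).1 (x l).2)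
        = ∑ i : Fin m,
            (π (tupleMG p n x hx) (tupleMG (k*p) n (y i) (hy i)) : ℝ)
              * Λ (fun l => ep (k*p) (y i l).1 (y i l).2)

/-- Adjacency relation of a multigraph. -/
def MG.adj (G : MG) (u v : Fin G.nv) : Prop :=
  ∃ e, (G.s e = u ∧ G.t e = v) ∨ (G.s e = v ∧ G.t e = u)

/-- The homomorphism density of the simplification `G^simp` of a multigraph `G`
(replace each family of parallel edges by a single edge). -/
def simpHomDensity (G : MG) (f : Kern) : ℝ :=
  ∫ x : Fin G.nv → ℝ,
    ∏ q ∈ Finset.univ.filter (fun q : Fin G.nv × Fin G.nv => q.1 < q.2 ∧ G.adj q.1 q.2),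
      f (x q.1) (x q.2) ∂(Measure.pi fun _ => μ01)

/-- Tensor product of two kernels with respect to a fixed measure-preserving map
`φ : [0,1] → [0,1]²`. -/
def tensProd (φ : ℝ → ℝ × ℝ) (f g : Kern) : Kern :=
  fun x y => f (φ x).1 (φ y).1 * g (φ x).2 (φ y).2

/-- `m`-fold tensor power of a kernel. -/
def tensPow (φ : ℝ → ℝ × ℝ) (f : Kern) : ℕ → Kern
  | 0 => fun _ _ => 1
  | 1 => f
  | (m+2) => tensProd φ f (tensPow φ f (m+1))

/-- A complete system of representatives for the isomorphism classes of multigraphs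
with no isolated vertices. -/
def IsRepSet (R : Set MG) : Prop :=
  (∀ G ∈ R, NoIsolated G) ∧ ∀ G : MG, NoIsolated G → ∃! H, H ∈ R ∧ MGIso G H

/-- A `k`-labelled multigraph: a multigraph together with an injective labelling of `k`
distinguished vertices. -/
structure LMG (k : ℕ) where
  G : MG
  lab : Fin k → Fin G.nv
  inj : Function.Injective lab

/-- No unlabelled isolated vertices. -/
def LMG.NoUnlabIsolated {k : ℕ} (H : LMG k) : Prop :=
  ∀ v, (∃ e, H.G.s e = v ∨ H.G.t e = v) ∨ ∃ a, H.lab a = v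

/-- Assignment of coordinates to the vertices of a `k`-labelled multigraph: labelled
vertices get the fixed values `x`, unlabelled ones the integration variables `y`. -/
def LMG.assign {k : ℕ} (H : LMG k) (x : Fin k → ℝ) (y : Fin H.G.nv → ℝ) :
    Fin H.G.nv → ℝ :=
  fun v => if h : ∃ a, H.lab a = v then x h.choose else y v

/-- The partially labelled homomorphism density `t_𝐱(H, f)`. -/
def lhom {k : ℕ} (H : LMG k) (x : Fin k → ℝ) (f : Kern) : ℝ :=
  ∫ y : Fin H.G.nv → ℝ,
    ∏ e : Fin H.G.ne, f (H.assign x y (H.G.s e)) (H.assign x y (H.G.t e))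
    ∂(Measure.pi fun _ => μ01)

/-- The weighted partially labelled homomorphism density `t_𝐱(H, f; w)`. -/
def wlhom {k : ℕ} (H : LMG k) (x : Fin k → ℝ) (f : Kern)
    (w : (Fin H.G.nv → ℝ) → ℝ) : ℝ :=
  ∫ y : Fin H.G.nv → ℝ,
    w (H.assign x y) *
      ∏ e : Fin H.G.ne, f (H.assign x y (H.G.s e)) (H.assign x y (H.G.t e))
    ∂(Measure.pi fun _ => μ01)

/-- The seminorm `‖w‖_{1,𝐱} = t_𝐱(H, 1, |w|)` of a weight. -/
def wnorm {k : ℕ} (H : LMG k) (x : Fin k → ℝ) (w : (Fin H.G.nv → ℝ) → ℝ) : ℝ :=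
  ∫ y : Fin H.G.nv → ℝ, |w (H.assign x y)| ∂(Measure.pi fun _ => μ01)

/-- Label-respecting isomorphism of `k`-labelled multigraphs. -/
def LMGIso {k : ℕ} (H H' : LMG k) : Prop :=
  ∃ (φv : Fin H.G.nv ≃ Fin H'.G.nv) (φe : Fin H.G.ne ≃ Fin H'.G.ne),
    (∀ e, ({H'.G.s (φe e), H'.G.t (φe e)} : Finset (Fin H'.G.nv))
        = {φv (H.G.s e), φv (H.G.t e)}) ∧
    ∀ a, φv (H.lab a) = H'.lab a

/-- A complete system of representatives for the label-respecting isomorphism classes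
of `k`-labelled multigraphs with no unlabelled isolated vertices. -/
def IsLRepSet (k : ℕ) (R : Set (LMG k)) : Prop :=
  (∀ H ∈ R, H.NoUnlabIsolated) ∧
  ∀ H : LMG k, H.NoUnlabIsolated → ∃! H', H' ∈ R ∧ LMGIso H H'

end


/-! ### Step kernels -/

/-- A map from `[0,1]` to a finite type which equidistributes. -/
def UnifMap {ι : Type} [Fintype ι] [MeasurableSpace ι] (κ : ℝ → ι) : Prop :=
  Measurable κ ∧ ∀ i, μ01 (κ ⁻¹' {i}) = (Fintype.card ι : ℝ≥0∞)⁻¹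

/-- The step kernel associated to a map and a matrix. -/
def stepK {ι : Type} (κ : ℝ → ι) (c : ι → ι → ℝ) : Kern := fun x y => c (κ x) (κ y)

instance isProb_mu01 : IsProbabilityMeasure μ01 := ⟨by simp [μ01]⟩

theorem homDensity_stepK {ι : Type} [Fintype ι] [MeasurableSpace ι] [MeasurableSingletonClass ι]
    (κ : ℝ → ι) (hκ : UnifMap κ) (c : ι → ι → ℝ) (G : MG) :
    homDensity G (stepK κ c) = ((Fintype.card ι : ℝ)⁻¹) ^ G.nv *
      ∑ φ : Fin G.nv → ι, ∏ e, c (φ (G.s e)) (φ (G.t e)) := by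
  have hprob : IsProbabilityMeasure (μ01.map κ) :=
    Measure.isProbabilityMeasure_map hκ.1.aemeasurable
  have hmp : MeasurePreserving (fun (x : Fin G.nv → ℝ) i => κ (x i))
      (Measure.pi fun _ => μ01) (Measure.pi fun _ => μ01.map κ) :=
    measurePreserving_pi (fun _ => μ01) (fun _ => μ01.map κ)
      (fun i => ⟨hκ.1, rfl⟩)
  have h1 : homDensity G (stepK κ c) = ∫ φ : Fin G.nv → ι, ∏ e, c (φ (G.s e)) (φ (G.t e))
      ∂(Measure.pi fun _ => μ01.map κ) := by
    rw [← hmp.map_eq, integral_map hmp.measurable.aemeasurable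
      (measurable_of_countable _).aestronglyMeasurable]
    rfl
  rw [h1, integral_fintype Integrable.of_finite, Finset.mul_sum]
  refine Finset.sum_congr rfl fun φ _ => ?_
  have h2 : (Measure.pi fun _ : Fin G.nv => μ01.map κ).real {φ}
      = ((Fintype.card ι : ℝ)⁻¹) ^ G.nv := by
    rw [Measure.real, ← Set.univ_pi_singleton, Measure.pi_pi, ENNReal.toReal_prod]
    have : ∀ i, ((μ01.map κ) {φ i}).toReal = (Fintype.card ι : ℝ)⁻¹ := by
      intro i
      rw [Measure.map_apply hκ.1 (measurableSet_singleton _), hκ.2]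
      simp
    simp [this]
  rw [h2, smul_eq_mul]

theorem stepK_graphon {ι : Type} [Fintype ι] [MeasurableSpace ι] [MeasurableSingletonClass ι]
    (κ : ℝ → ι) (hκ : Measurable κ) (c : ι → ι → ℝ) (hs : ∀ a b, c a b = c b a)
    (h01 : ∀ a b, c a b ∈ Set.Icc (0:ℝ) 1) : stepK κ c ∈ Graphons := by
  refine ⟨⟨?_, fun x y => hs _ _⟩, fun x y => h01 _ _⟩
  have : Function.uncurry (stepK κ c) = (Function.uncurry c) ∘ (fun q : ℝ × ℝ => (κ q.1, κ q.2)) := by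
    ext ⟨x, y⟩; rfl
  rw [this]
  exact (measurable_of_countable _).comp
    ((hκ.comp measurable_fst).prodMk (hκ.comp measurable_snd))

/-- The index of the cell containing `x`. -/
noncomputable def kap (p : ℕ) [NeZero p] (x : ℝ) : Fin p :=
  ⟨min ⌊(p:ℝ) * x⌋₊ (p - 1), by have := NeZero.pos p; omega⟩

theorem measurable_kap (p : ℕ) [NeZero p] : Measurable (kap p) := by
  refine measurable_to_countable' fun a => ?_
  have : kap p ⁻¹' {a} = (fun x : ℝ => min ⌊(p:ℝ) * x⌋₊ (p - 1)) ⁻¹' {(a : ℕ)} := by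
    ext x
    simp [kap, Fin.ext_iff]
  rw [this]
  have hm : Measurable (fun x : ℝ => min ⌊(p:ℝ) * x⌋₊ (p - 1)) :=
    (Nat.measurable_floor.comp (measurable_const.mul measurable_id)).min measurable_const
  exact hm (measurableSet_singleton _)

theorem unif_kap (p : ℕ) [NeZero p] : UnifMap (kap p) := by
  refine ⟨measurable_kap p, fun a => ?_⟩
  have hp : (0:ℝ) < p := by exact_mod_cast NeZero.pos p
  have hap : ((a:ℕ):ℝ) + 1 ≤ p := by exact_mod_cast a.2
  have hvol : ENNReal.ofReal ((((a:ℕ):ℝ) + 1) / p - ((a:ℕ):ℝ) / p)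
      = (Fintype.card (Fin p) : ℝ≥0∞)⁻¹ := by
    rw [← sub_div, add_sub_cancel_left, one_div, ENNReal.ofReal_inv_of_pos hp]
    simp
  rw [Measure.restrict_apply (measurable_kap p (measurableSet_singleton _))]
  apply le_antisymm
  · rw [← hvol, ← Real.volume_Icc]
    apply measure_mono
    rintro x ⟨hx, hx0, hx1⟩
    have hx' : min ⌊(p:ℝ) * x⌋₊ (p - 1) = a := by
      simpa [kap, Fin.ext_iff] using hx
    have hnn : 0 ≤ (p:ℝ) * x := by positivity
    constructor
    · rw [div_le_iff₀ hp]
      have : (a:ℕ) ≤ ⌊(p:ℝ) * x⌋₊ := by omega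
      have h3 := (Nat.le_floor_iff hnn).1 this
      linarith
    · rw [le_div_iff₀ hp]
      by_cases h : ⌊(p:ℝ) * x⌋₊ ≤ p - 1
      · have h4 := Nat.lt_floor_add_one ((p:ℝ) * x)
        have : ⌊(p:ℝ) * x⌋₊ = a := by omega
        rw [this] at h4
        linarith
      · have h5 : (a:ℕ) + 1 = p := by have := NeZero.pos p; omega
        have h6 : ((a:ℕ):ℝ) + 1 = p := by exact_mod_cast h5
        rw [h6]
        nlinarith
  · rw [← hvol, ← Real.volume_Ioo]
    apply measure_mono
    rintro x ⟨hx0, hx1⟩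
    rw [div_lt_iff₀ hp] at hx0
    rw [lt_div_iff₀ hp] at hx1
    have hnn : 0 ≤ (p:ℝ) * x := by
      have : (0:ℝ) ≤ (a:ℕ) := by positivity
      nlinarith
    have hfl : ⌊(p:ℝ) * x⌋₊ = a := by
      rw [Nat.floor_eq_iff hnn]
      constructor <;> nlinarith
    refine ⟨?_, ?_, ?_⟩
    · simp only [Set.mem_preimage, Set.mem_singleton_iff, kap, Fin.ext_iff, hfl]
      omega
    · by_contra hc
      push Not at hc
      nlinarith
    · by_contra hc
      push Not at hc
      nlinarith

theorem kap_mul (p k : ℕ) [NeZero p] [NeZero k] [NeZero (p * k)] (x : ℝ) :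
    (finProdFinEquiv.symm (kap (p * k) x)).1 = kap p x := by
  have hk : 0 < k := NeZero.pos k
  have hp : 0 < p := NeZero.pos p
  have hkR : (k:ℝ) ≠ 0 := by positivity
  apply Fin.ext
  simp only [finProdFinEquiv, Equiv.coe_fn_symm_mk, Fin.divNat, kap]
  have h1 : ⌊(p:ℝ) * x⌋₊ = ⌊((p * k : ℕ):ℝ) * x⌋₊ / k := by
    rw [← Nat.floor_div_natCast]
    congr 1
    push_cast
    field_simp
  rw [h1]
  generalize ⌊((p * k : ℕ):ℝ) * x⌋₊ = m
  rcases le_total m (p * k - 1) with h | h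
  · rw [min_eq_left h, min_eq_left]
    have : m < p * k := by have := Nat.mul_pos hp hk; omega
    have := (Nat.div_lt_iff_lt_mul hk).2 this
    omega
  · rw [min_eq_right h]
    have e1 : (p * k - 1) / k = p - 1 := by
      obtain ⟨q, rfl⟩ : ∃ q, p = q + 1 := ⟨p - 1, by omega⟩
      have : (q + 1) * k - 1 = (k - 1) + k * q := by
        rw [Nat.add_mul, Nat.one_mul, Nat.mul_comm]; omega
      rw [this, Nat.add_mul_div_left _ _ hk, Nat.div_eq_of_lt (by omega)]
      omega
    have e2 : (p * k - 1) / k ≤ m / k := Nat.div_le_div_right h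
    omega

theorem unif_equiv {ι ι' : Type} [Fintype ι] [MeasurableSpace ι] [MeasurableSingletonClass ι]
    [Fintype ι'] [MeasurableSpace ι'] [MeasurableSingletonClass ι'] (κ : ℝ → ι) (hκ : UnifMap κ)
    (e : ι ≃ ι') : UnifMap (fun x => e (κ x)) := by
  refine ⟨(measurable_of_countable _).comp hκ.1, fun i => ?_⟩
  rw [← Fintype.card_congr e, ← hκ.2 (e.symm i)]
  congr 1
  ext x
  simp [Equiv.eq_symm_apply]


/-! ### Multigraph combinatorics -/

theorem nv_le_of_noIsolated (G : MG) (h : NoIsolated G) : G.nv ≤ 2 * G.ne := by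
  have hs : Function.Surjective (Sum.elim G.s G.t) := by
    intro v
    obtain ⟨e, he | he⟩ := h v
    · exact ⟨Sum.inl e, he⟩
    · exact ⟨Sum.inr e, he⟩
  have := Fintype.card_le_of_surjective _ hs
  simp at this
  omega

theorem finite_good (N : ℕ) : {G : MG | G.ne ≤ N ∧ NoIsolated G}.Finite := by
  have hsub : {G : MG | G.ne ≤ N ∧ NoIsolated G} ⊆
      ⋃ a ∈ Set.Iic (2 * N), ⋃ b ∈ Set.Iic N, {G : MG | G.nv = a ∧ G.ne = b} := by
    rintro G ⟨h1, h2⟩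
    have := nv_le_of_noIsolated G h2
    simp only [Set.mem_iUnion, Set.mem_Iic]
    exact ⟨G.nv, by omega, G.ne, h1, rfl, rfl⟩
  refine Set.Finite.subset ?_ hsub
  refine Set.Finite.biUnion (Set.finite_Iic _) fun a _ => ?_
  refine Set.Finite.biUnion (Set.finite_Iic _) fun b _ => ?_
  have : {G : MG | G.nv = a ∧ G.ne = b} ⊆ Set.range
      (fun st : {st : (Fin b → Fin a) × (Fin b → Fin a) // ∀ e, st.1 e ≠ st.2 e} =>
        (⟨a, b, st.1.1, st.1.2, st.2⟩ : MG)) := by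
    rintro ⟨nv, ne, s, t, h⟩ ⟨h1, h2⟩
    dsimp at h1 h2
    subst h1 h2
    exact ⟨⟨(s, t), h⟩, rfl⟩
  exact (Set.finite_range _).subset this

/-- The finite set of multigraphs with at most `N` edges and no isolated vertices. -/
noncomputable def goodFin (N : ℕ) : Finset MG := (finite_good N).toFinset

theorem mem_goodFin {N : ℕ} {G : MG} : G ∈ goodFin N ↔ G.ne ≤ N ∧ NoIsolated G := by
  simp [goodFin]

theorem finsum_good {N : ℕ} {a : MG → ℝ} (ha : GoodCoeffs N a) (u : MG → ℝ) :
    ∑ᶠ G : MG, a G * u G = ∑ G ∈ goodFin N, a G * u G := by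
  refine finsum_eq_sum_of_support_subset _ fun G hG => ?_
  by_contra hc
  simp only [Finset.mem_coe, mem_goodFin] at hc
  exact hG (by simp [ha.2 G hc])

/-- The space of good coefficient families. -/
def goodV (N : ℕ) : Submodule ℝ (MG → ℝ) where
  carrier := {a | GoodCoeffs N a}
  add_mem' := by
    rintro a b ⟨ha1, ha2⟩ ⟨hb1, hb2⟩
    exact ⟨fun G H h => by simp [ha1 G H h, hb1 G H h], fun G h => by simp [ha2 G h, hb2 G h]⟩
  zero_mem' := ⟨fun G H h => rfl, fun G h => rfl⟩
  smul_mem' := by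
    rintro c a ⟨ha1, ha2⟩
    exact ⟨fun G H h => by simp [ha1 G H h], fun G h => by simp [ha2 G h]⟩

theorem mem_goodV {N : ℕ} {a : MG → ℝ} : a ∈ goodV N ↔ GoodCoeffs N a := Iff.rfl

instance finDim_goodV (N : ℕ) : FiniteDimensional ℝ (goodV N) := by
  let L : goodV N →ₗ[ℝ] (goodFin N → ℝ) :=
    { toFun := fun a G => a.1 G.1
      map_add' := fun a b => rfl
      map_smul' := fun c a => rfl }
  refine FiniteDimensional.of_injective L ?_
  rw [injective_iff_map_eq_zero]
  intro a ha
  ext G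
  by_cases hG : G ∈ goodFin N
  · exact congrFun ha ⟨G, hG⟩
  · exact a.2.2 G (by simpa [mem_goodFin] using hG)

theorem pair_eq_of_sym2 {α : Type} [DecidableEq α] {a b c d : α} (h : s(a, b) = s(c, d)) :
    ({a, b} : Finset α) = {c, d} := by
  rcases Sym2.eq_iff.1 h with ⟨rfl, rfl⟩ | ⟨rfl, rfl⟩
  · rfl
  · exact Finset.pair_comm _ _

theorem sym2_of_pair_eq {α : Type} [DecidableEq α] {a b c d : α} (hab : a ≠ b)
    (h : ({a, b} : Finset α) = {c, d}) : s(a, b) = s(c, d) := by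
  have h1 : a = c ∨ a = d := by
    have : a ∈ ({c, d} : Finset α) := h ▸ (by simp)
    simpa using this
  have h2 : b = c ∨ b = d := by
    have : b ∈ ({c, d} : Finset α) := h ▸ (by simp)
    simpa using this
  rw [Sym2.eq_iff]
  rcases h1 with rfl | rfl <;> rcases h2 with rfl | rfl <;> simp_all

theorem MGIso.sym2 {G H : MG} (φ : MGHom G H) (e : Fin G.ne) :
    s(H.s (φ.eMap e), H.t (φ.eMap e)) = s(φ.vMap (G.s e), φ.vMap (G.t e)) :=
  sym2_of_pair_eq (H.noLoop _) (φ.compat e)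

theorem MGIso.symm' {G H : MG} (h : MGIso G H) : MGIso H G := by
  obtain ⟨φ, hv, he⟩ := h
  let ev := Equiv.ofBijective _ hv
  let ee := Equiv.ofBijective _ he
  refine ⟨⟨ev.symm, ee.symm, fun e => ?_⟩, ev.symm.bijective, ee.symm.bijective⟩
  apply pair_eq_of_sym2
  have h1 := MGIso.sym2 φ (ee.symm e)
  have h2 : φ.eMap (ee.symm e) = e := ee.apply_symm_apply e
  rw [h2] at h1
  apply Sym2.map.injective ev.injective
  simp only [Sym2.map_mk, Equiv.apply_symm_apply]
  exact h1.symm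

theorem MGIso.good {N : ℕ} {G H : MG} (h : MGIso G H) (hG : G.ne ≤ N ∧ NoIsolated G) :
    H.ne ≤ N ∧ NoIsolated H := by
  obtain ⟨φ, hv, he⟩ := h
  have hc := Fintype.card_congr (Equiv.ofBijective _ he)
  simp at hc
  refine ⟨by omega, fun v => ?_⟩
  obtain ⟨u, rfl⟩ := hv.2 v
  obtain ⟨e, hu⟩ := hG.2 u
  refine ⟨φ.eMap e, ?_⟩
  rcases Sym2.eq_iff.1 (MGIso.sym2 φ e) with ⟨h1, h2⟩ | ⟨h1, h2⟩
  · rcases hu with rfl | rfl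
    · exact Or.inl h1
    · exact Or.inr h2
  · rcases hu with rfl | rfl
    · exact Or.inr h2
    · exact Or.inl h1

/-! ### Edge variables -/

/-- Unordered pairs of distinct elements of `Fin p`. -/
abbrev Ed (p : ℕ) : Type := {z : Sym2 (Fin p) // ¬ z.IsDiag}

/-- The pair as an edge variable. -/
def mkEd {p : ℕ} (a b : Fin p) (h : a ≠ b) : Ed p := ⟨s(a, b), by simpa using h⟩

/-- Extension of a family indexed by edges to a matrix with zero diagonal. -/
noncomputable def extC {p : ℕ} {R : Type} [Zero R] (c : Ed p → R) (a b : Fin p) : R :=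
  if h : a ≠ b then c (mkEd a b h) else 0

/-- The monomial attached to a multigraph and a map of its vertices to `Fin p`. -/
noncomputable def emon {p : ℕ} (G : MG) (φ : Fin G.nv → Fin p)
    (h : ∀ e, φ (G.s e) ≠ φ (G.t e)) : Ed p →₀ ℕ :=
  ∑ e, Finsupp.single (mkEd (φ (G.s e)) (φ (G.t e)) (h e)) 1

theorem prod_extC {p : ℕ} (G : MG) (φ : Fin G.nv → Fin p) :
    (∏ e, extC (MvPolynomial.X (R := ℝ)) (φ (G.s e)) (φ (G.t e)))
      = if h : ∀ e, φ (G.s e) ≠ φ (G.t e) then MvPolynomial.monomial (emon G φ h) (1:ℝ) else 0 := by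
  split_ifs with h
  · rw [emon, MvPolynomial.monomial_sum_one]
    refine Finset.prod_congr rfl fun e _ => ?_
    rw [extC, dif_pos (h e)]
    rfl
  · push Not at h
    obtain ⟨e, he⟩ := h
    refine Finset.prod_eq_zero (Finset.mem_univ e) ?_
    simp [extC, he]

/-- The polynomial computing the homomorphism density in a step kernel. -/
noncomputable def homP (p : ℕ) (G : MG) : MvPolynomial (Ed p) ℝ :=
  MvPolynomial.C (((p : ℝ)⁻¹) ^ G.nv) *
    ∑ φ : Fin G.nv → Fin p, ∏ e, extC MvPolynomial.X (φ (G.s e)) (φ (G.t e))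

theorem eval_extC {p : ℕ} (c : Ed p → ℝ) (a b : Fin p) :
    MvPolynomial.eval c (extC MvPolynomial.X a b) = extC c a b := by
  unfold extC
  split_ifs <;> simp

theorem eval_homP (p : ℕ) [NeZero p] (G : MG) (c : Ed p → ℝ) :
    MvPolynomial.eval c (homP p G) = homDensity G (stepK (kap p) (extC c)) := by
  rw [homDensity_stepK _ (unif_kap p)]
  simp [homP, eval_extC]

theorem coeff_homP (p : ℕ) (G : MG) (m : Ed p →₀ ℕ) :
    MvPolynomial.coeff m (homP p G) = ((p : ℝ)⁻¹) ^ G.nv *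
      ∑ φ : Fin G.nv → Fin p, if ∃ h : ∀ e, φ (G.s e) ≠ φ (G.t e), emon G φ h = m
        then (1:ℝ) else 0 := by
  rw [homP, MvPolynomial.coeff_C_mul, MvPolynomial.coeff_sum]
  congr 1
  refine Finset.sum_congr rfl fun φ _ => ?_
  rw [prod_extC]
  by_cases h : ∀ e, φ (G.s e) ≠ φ (G.t e)
  · simp [h, MvPolynomial.coeff_monomial]
  · simp [h]

theorem exists_equiv_of_sum_single {α β γ : Type} [Fintype α] [Fintype β] (q : α → γ) (q' : β → γ)
    (h : ∑ i, Finsupp.single (q i) (1:ℕ) = ∑ i, Finsupp.single (q' i) (1:ℕ)) :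
    ∃ e : α ≃ β, ∀ i, q' (e i) = q i := by
  have key : ∀ g : γ, Fintype.card {a // q a = g} = Fintype.card {b // q' b = g} := by
    intro g
    have := DFunLike.congr_fun h g
    simp only [Finsupp.coe_finsetSum, Finset.sum_apply, Finsupp.single_apply] at this
    rw [Fintype.card_subtype, Fintype.card_subtype, Finset.card_filter, Finset.card_filter]
    exact this
  let e := Equiv.ofFiberEquiv (f := q) (g := q') (fun g => Fintype.equivOfCardEq (key g))
  exact ⟨e, fun i => Equiv.ofFiberEquiv_map _ i⟩

theorem emon_eq_equiv {p : ℕ} {G H : MG} {φ : Fin G.nv → Fin p} {ψ : Fin H.nv → Fin p}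
    {h : ∀ e, φ (G.s e) ≠ φ (G.t e)} {h' : ∀ e, ψ (H.s e) ≠ ψ (H.t e)}
    (heq : emon G φ h = emon H ψ h') :
    ∃ e : Fin G.ne ≃ Fin H.ne, ∀ i, s(ψ (H.s (e i)), ψ (H.t (e i))) = s(φ (G.s i), φ (G.t i)) := by
  obtain ⟨e, he⟩ := exists_equiv_of_sum_single _ _ heq
  exact ⟨e, fun i => congrArg Subtype.val (he i)⟩

theorem iso_of_emon_eq {p : ℕ} {G H : MG} {φ : Fin G.nv → Fin p} {ψ : Fin H.nv → Fin p}
    {h : ∀ e, φ (G.s e) ≠ φ (G.t e)} {h' : ∀ e, ψ (H.s e) ≠ ψ (H.t e)}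
    (hψ : Function.Injective ψ) (hH : NoIsolated H)
    (heq : emon G φ h = emon H ψ h') : H.nv ≤ G.nv ∧ (G.nv ≤ H.nv → MGIso G H) := by
  obtain ⟨e, he⟩ := emon_eq_equiv heq
  have hr : ∀ v, ∃ u, φ u = ψ v := by
    intro v
    obtain ⟨i, hi⟩ := hH v
    have h1 := he (e.symm i)
    rw [e.apply_symm_apply] at h1
    rcases Sym2.eq_iff.1 h1 with ⟨h2, h3⟩ | ⟨h2, h3⟩
    · rcases hi with rfl | rfl
      · exact ⟨_, h2.symm⟩
      · exact ⟨_, h3.symm⟩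
    · rcases hi with rfl | rfl
      · exact ⟨_, h2.symm⟩
      · exact ⟨_, h3.symm⟩
  choose ρ hρ using hr
  have hρi : Function.Injective ρ := by
    intro a b hab
    apply hψ
    rw [← hρ, ← hρ, hab]
  have hle := Fintype.card_le_of_injective ρ hρi
  simp only [Fintype.card_fin] at hle
  refine ⟨hle, fun hge => ?_⟩
  have hb : Function.Bijective ρ := by
    rw [Fintype.bijective_iff_injective_and_card]
    exact ⟨hρi, by simp; omega⟩
  let r := Equiv.ofBijective ρ hb
  have hr' : ∀ u, ψ (r.symm u) = φ u := by
    intro u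
    rw [← hρ]
    exact congrArg φ (r.apply_symm_apply u)
  refine ⟨⟨r.symm, e, fun i => ?_⟩, r.symm.bijective, e.bijective⟩
  apply pair_eq_of_sym2
  apply Sym2.map.injective hψ
  simp only [Sym2.map_mk, hr']
  exact he i

/-- The polynomial of a linear combination of homomorphism densities. -/
noncomputable def PhiP (N p : ℕ) : (MG → ℝ) →ₗ[ℝ] MvPolynomial (Ed p) ℝ where
  toFun a := ∑ G ∈ goodFin N, a G • homP p G
  map_add' a b := by simp [add_smul, Finset.sum_add_distrib]
  map_smul' c a := by simp [Finset.smul_sum, smul_smul]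

theorem PhiP_apply (N p : ℕ) (a : MG → ℝ) : PhiP N p a = ∑ G ∈ goodFin N, a G • homP p G := rfl

theorem PhiP_inj {N p : ℕ} (hp0 : 0 < p) (hp : 2 * N ≤ p) {a : MG → ℝ} (ha : GoodCoeffs N a)
    (h0 : PhiP N p a = 0) : a = 0 := by
  by_contra hne
  obtain ⟨G0, hG0⟩ := Function.ne_iff.1 hne
  have hmem : ∀ G, a G ≠ 0 → G ∈ goodFin N := by
    intro G hG
    rw [mem_goodFin]
    by_contra hc
    exact hG (ha.2 G hc)
  obtain ⟨H, hH, hmax⟩ := Finset.exists_max_image ((goodFin N).filter (fun G => a G ≠ 0))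
    (fun G => G.nv) ⟨G0, by simp [hmem G0 hG0]; exact hG0⟩
  rw [Finset.mem_filter] at hH
  have hgH := mem_goodFin.1 hH.1
  have hnv : H.nv ≤ p := by
    have := nv_le_of_noIsolated H hgH.2
    have := hgH.1
    omega
  let ψ : Fin H.nv → Fin p := Fin.castLE hnv
  have hψ : Function.Injective ψ := Fin.castLE_injective hnv
  have h' : ∀ e, ψ (H.s e) ≠ ψ (H.t e) := fun e he => H.noLoop e (hψ he)
  have hco := congrArg (MvPolynomial.coeff (emon H ψ h')) h0
  rw [PhiP_apply, MvPolynomial.coeff_sum, MvPolynomial.coeff_zero] at hco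
  simp only [MvPolynomial.coeff_smul, smul_eq_mul] at hco
  have hpp : (0:ℝ) < (p:ℝ)⁻¹ := by positivity
  have hnonneg : ∀ G : MG, 0 ≤ MvPolynomial.coeff (emon H ψ h') (homP p G) := by
    intro G
    rw [coeff_homP]
    exact mul_nonneg (by positivity) (Finset.sum_nonneg fun φ _ => by split_ifs <;> norm_num)
  have hterm : ∀ G ∈ goodFin N, a G * MvPolynomial.coeff (emon H ψ h') (homP p G)
      = a H * (if a G = a H then MvPolynomial.coeff (emon H ψ h') (homP p G) else 0) := by
    intro G hG
    split_ifs with hiso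
    · rw [hiso]
    · rw [mul_zero]
      by_cases hz : a G = 0
      · simp [hz]
      rw [coeff_homP, Finset.sum_eq_zero, mul_zero, mul_zero]
      intro φ _
      rw [if_neg]
      rintro ⟨hh, heq⟩
      have h1 := (iso_of_emon_eq hψ hgH.2 heq).2 (hmax G (by simp [hG, hz]))
      exact hiso (ha.1 _ _ h1)
  rw [Finset.sum_congr rfl hterm, ← Finset.mul_sum] at hco
  have hpos : 0 < ∑ G ∈ goodFin N,
      (if a G = a H then MvPolynomial.coeff (emon H ψ h') (homP p G) else 0) := by
    refine Finset.sum_pos' (fun G _ => by split_ifs; exacts [hnonneg G, le_rfl]) ⟨H, hH.1, ?_⟩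
    rw [if_pos rfl, coeff_homP]
    refine mul_pos (by positivity) ?_
    refine Finset.sum_pos' (fun φ _ => by split_ifs <;> norm_num) ⟨ψ, Finset.mem_univ _, ?_⟩
    rw [if_pos ⟨h', rfl⟩]
    norm_num
  rcases mul_eq_zero.1 hco with h1 | h1
  · exact hH.2 h1
  · exact hpos.ne' h1

theorem eval_PhiP {N p : ℕ} [NeZero p] {a : MG → ℝ} (ha : GoodCoeffs N a) (c : Ed p → ℝ) :
    MvPolynomial.eval c (PhiP N p a)
      = ∑ᶠ G : MG, a G * homDensity G (stepK (kap p) (extC c)) := by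
  rw [finsum_good ha, PhiP_apply, map_sum]
  refine Finset.sum_congr rfl fun G _ => ?_
  rw [MvPolynomial.smul_eval, eval_homP]

/-- A polynomial vanishing on the cube is zero. -/
theorem mvpoly_zero_of_cube {σ : Type} (P : MvPolynomial σ ℝ)
    (h : ∀ c : σ → ℝ, (∀ i, c i ∈ Set.Icc (0:ℝ) 1) → MvPolynomial.eval c P = 0) : P = 0 := by
  refine MvPolynomial.funext_set (fun _ => Set.Icc (0:ℝ) 1)
    (fun _ => Set.Icc_infinite (by norm_num)) fun c hc => ?_
  rw [map_zero]
  exact h c fun i => hc i (Set.mem_univ i)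

theorem extC_graphon {p : ℕ} [NeZero p] (c : Ed p → ℝ) (hc : ∀ i, c i ∈ Set.Icc (0:ℝ) 1) :
    stepK (kap p) (extC c) ∈ Graphons := by
  refine stepK_graphon _ (measurable_kap p) _ (fun a b => ?_) (fun a b => ?_)
  · unfold extC
    by_cases h : a = b
    · simp [h]
    · rw [dif_pos h, dif_pos (Ne.symm h)]
      congr 1
      simp [mkEd, Sym2.eq_swap]
  · unfold extC
    split_ifs
    · exact hc _
    · simp

theorem coeffs_zero {N p : ℕ} [NeZero p] (hp : 2 * N ≤ p) {a : MG → ℝ} (ha : GoodCoeffs N a)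
    (h : ∀ c : Ed p → ℝ, (∀ i, c i ∈ Set.Icc (0:ℝ) 1) →
      ∑ᶠ G : MG, a G * homDensity G (stepK (kap p) (extC c)) = 0) : a = 0 := by
  refine PhiP_inj (NeZero.pos p) hp ha (mvpoly_zero_of_cube _ fun c hc => ?_)
  rw [eval_PhiP ha, h c hc]


/-! ### Invariant polynomials are combinations of homomorphism densities -/

/-- The action of permutations on edge variables. -/
def edPerm {p : ℕ} (σ : Equiv.Perm (Fin p)) (z : Ed p) : Ed p :=
  ⟨Sym2.map σ z.1, by
    obtain ⟨z, hz⟩ := z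
    induction z with
    | h a b => simpa using hz⟩

theorem edPerm_mk {p : ℕ} (σ : Equiv.Perm (Fin p)) (a b : Fin p) (h : a ≠ b) :
    edPerm σ (mkEd a b h) = mkEd (σ a) (σ b) (fun h' => h (σ.injective h')) := rfl

theorem edPerm_inj {p : ℕ} (σ : Equiv.Perm (Fin p)) : Function.Injective (edPerm σ) := by
  intro x y h
  exact Subtype.ext (Sym2.map.injective σ.injective (congrArg Subtype.val h))

theorem emon_perm {p : ℕ} (σ : Equiv.Perm (Fin p)) (G : MG) (φ : Fin G.nv → Fin p)
    (h : ∀ e, φ (G.s e) ≠ φ (G.t e)) :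
    Finsupp.mapDomain (edPerm σ) (emon G φ h)
      = emon G (σ ∘ φ) (fun e h' => h e (σ.injective h')) := by
  rw [emon, Finsupp.mapDomain_finsetSum]
  refine Finset.sum_congr rfl fun e _ => ?_
  rw [Finsupp.mapDomain_single, edPerm_mk]
  rfl

/-- Invariance of a polynomial under vertex permutations. -/
def InvP {p : ℕ} (P : MvPolynomial (Ed p) ℝ) : Prop :=
  ∀ σ : Equiv.Perm (Fin p), MvPolynomial.rename (edPerm σ) P = P

theorem InvP.coeff {p : ℕ} {P : MvPolynomial (Ed p) ℝ} (hP : InvP P) (σ : Equiv.Perm (Fin p))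
    (G : MG) (φ : Fin G.nv → Fin p) (h : ∀ e, φ (G.s e) ≠ φ (G.t e)) :
    MvPolynomial.coeff (emon G (σ ∘ φ) (fun e h' => h e (σ.injective h'))) P
      = MvPolynomial.coeff (emon G φ h) P := by
  conv_lhs => rw [← hP σ, ← emon_perm]
  exact MvPolynomial.coeff_rename_mapDomain _ (edPerm_inj σ) _ _

theorem exists_perm {n p : ℕ} (φ ψ : Fin n → Fin p) (hφ : Function.Injective φ)
    (hψ : Function.Injective ψ) : ∃ σ : Equiv.Perm (Fin p), σ ∘ φ = ψ := by
  let e : {x // x ∈ Set.range φ} ≃ {x // x ∈ Set.range ψ} :=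
    (Equiv.ofInjective φ hφ).symm.trans (Equiv.ofInjective ψ hψ)
  refine ⟨e.extendSubtype, ?_⟩
  ext i
  simp only [Function.comp]
  rw [Equiv.extendSubtype_apply_of_mem e (φ i) ⟨i, rfl⟩]
  simp [e]

theorem InvP.coeff' {p : ℕ} {P : MvPolynomial (Ed p) ℝ} (hP : InvP P)
    (G : MG) (φ ψ : Fin G.nv → Fin p) (hφ : Function.Injective φ)
    (hψ : Function.Injective ψ) (h : ∀ e, φ (G.s e) ≠ φ (G.t e))
    (h' : ∀ e, ψ (G.s e) ≠ ψ (G.t e)) :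
    MvPolynomial.coeff (emon G φ h) P = MvPolynomial.coeff (emon G ψ h') P := by
  obtain ⟨σ, rfl⟩ := exists_perm φ ψ hφ hψ
  exact (hP.coeff σ G φ h).symm

theorem extC_rename {p : ℕ} (σ : Equiv.Perm (Fin p)) (a b : Fin p) :
    MvPolynomial.rename (edPerm σ) (extC (MvPolynomial.X (R := ℝ)) a b)
      = extC MvPolynomial.X (σ a) (σ b) := by
  unfold extC
  by_cases h : a = b
  · simp [h]
  · have h' : σ a ≠ σ b := fun h' => h (σ.injective h')
    rw [dif_pos h, dif_pos h', MvPolynomial.rename_X, edPerm_mk]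

theorem homP_inv (p : ℕ) (G : MG) : InvP (homP p G) := by
  intro σ
  simp only [homP, map_mul, map_sum, map_prod, MvPolynomial.rename_C, extC_rename]
  congr 1
  exact Fintype.sum_equiv (Equiv.arrowCongr (Equiv.refl _) σ) _ _ (fun φ => by simp)

theorem homP_deg (p : ℕ) (G : MG) : (homP p G).totalDegree ≤ G.ne := by
  refine (MvPolynomial.totalDegree_mul _ _).trans ?_
  rw [MvPolynomial.totalDegree_C, zero_add]
  refine (MvPolynomial.totalDegree_finsetSum _ _).trans (Finset.sup_le fun φ _ => ?_)
  refine (MvPolynomial.totalDegree_finsetProd _ _).trans ?_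
  calc _ ≤ ∑ e : Fin G.ne, 1 := Finset.sum_le_sum fun e _ => ?_
    _ = G.ne := by simp
  unfold extC
  split_ifs
  · exact (MvPolynomial.totalDegree_X _).le
  · simp

theorem PhiP_inv (N p : ℕ) (a : MG → ℝ) : InvP (PhiP N p a) := by
  intro σ
  rw [PhiP_apply, map_sum]
  refine Finset.sum_congr rfl fun G _ => ?_
  rw [map_smul, homP_inv]

theorem PhiP_deg (N p : ℕ) (a : MG → ℝ) : (PhiP N p a).totalDegree ≤ N := by
  rw [PhiP_apply]
  refine (MvPolynomial.totalDegree_finsetSum _ _).trans (Finset.sup_le fun G hG => ?_)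
  refine (MvPolynomial.totalDegree_smul_le _ _).trans ((homP_deg p G).trans ?_)
  exact (mem_goodFin.1 hG).1

theorem nv_le_p {N p : ℕ} (hp : 2 * N ≤ p) {G : MG} (hG : G.ne ≤ N ∧ NoIsolated G) : G.nv ≤ p := by
  have := nv_le_of_noIsolated G hG.2
  have := hG.1
  omega

/-- Coefficients of a polynomial at the monomials attached to multigraphs. -/
noncomputable def Rc {N p : ℕ} (hp : 2 * N ≤ p) (P : MvPolynomial (Ed p) ℝ) (G : MG) : ℝ :=
  if hG : G.ne ≤ N ∧ NoIsolated G then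
    MvPolynomial.coeff (emon G (Fin.castLE (nv_le_p hp hG))
      (fun e he => G.noLoop e (Fin.castLE_injective _ he))) P
  else 0

theorem Rc_good {N p : ℕ} (hp : 2 * N ≤ p) {P : MvPolynomial (Ed p) ℝ} (hP : InvP P) :
    GoodCoeffs N (Rc hp P) := by
  refine ⟨fun G H hGH => ?_, fun G hG => by rw [Rc, dif_neg hG]⟩
  by_cases hG : G.ne ≤ N ∧ NoIsolated G
  · have hH := hGH.good hG
    rw [Rc, Rc, dif_pos hG, dif_pos hH]
    obtain ⟨φ, hv, he⟩ := hGH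
    let ψ : Fin H.nv → Fin p := Fin.castLE (nv_le_p hp hH)
    have hψ : Function.Injective ψ := Fin.castLE_injective _
    rw [hP.coeff' G _ (ψ ∘ φ.vMap) (Fin.castLE_injective _) (hψ.comp hv.1) _
      (fun e h => G.noLoop e ((hψ.comp hv.1) h))]
    congr 1
    unfold emon
    refine Fintype.sum_bijective φ.eMap he _ _ fun e => ?_
    congr 1
    apply Subtype.ext
    simp only [mkEd, Function.comp]
    have h1 := MGIso.sym2 φ e
    have h2 := congrArg (Sym2.map ψ) h1
    simp only [Sym2.map_mk] at h2
    exact h2.symm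
  · have hH : ¬ (H.ne ≤ N ∧ NoIsolated H) := fun hH => hG ((hGH.symm').good hH)
    rw [Rc, Rc, dif_neg hG, dif_neg hH]

theorem exists_graph_of_mon {p : ℕ} (m : Ed p →₀ ℕ) :
    ∃ (G : MG) (φ : Fin G.nv → Fin p) (h : ∀ e, φ (G.s e) ≠ φ (G.t e)),
      Function.Injective φ ∧ NoIsolated G ∧ G.ne = m.sum (fun _ k => k) ∧ emon G φ h = m := by
  set L : List (Ed p) := (Finsupp.toMultiset m).toList with hL
  have hLm : (L : Multiset (Ed p)) = Finsupp.toMultiset m := Multiset.coe_toList _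
  have hlen : L.length = m.sum (fun _ k => k) := by
    rw [hL, Multiset.length_toList, Finsupp.card_toMultiset]; rfl
  have hrep : ∀ i : Fin L.length, ∃ a b : Fin p, ∃ h : a ≠ b, mkEd a b h = L.get i := by
    intro i
    obtain ⟨z, hz⟩ := L.get i
    induction z with
    | h a b => exact ⟨a, b, by simpa using hz, rfl⟩
  choose a b hab hrep using hrep
  let S : Type := {v : Fin p // ∃ i, a i = v ∨ b i = v}
  let E : S ≃ Fin (Fintype.card S) := Fintype.equivFin S
  let G : MG := ⟨Fintype.card S, L.length, fun i => E ⟨a i, i, Or.inl rfl⟩,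
    fun i => E ⟨b i, i, Or.inr rfl⟩, fun i h => hab i (congrArg Subtype.val (E.injective h))⟩
  refine ⟨G, fun v => (E.symm v).1, fun i => ?_, ?_, ?_, hlen, ?_⟩
  · simpa [G] using hab i
  · exact Subtype.val_injective.comp E.symm.injective
  · intro v
    obtain ⟨i, hi⟩ := (E.symm v).2
    refine ⟨i, ?_⟩
    rcases hi with hi | hi
    · left
      rw [← E.apply_symm_apply v]
      exact congrArg E (Subtype.ext hi)
    · right
      rw [← E.apply_symm_apply v]
      exact congrArg E (Subtype.ext hi)
  · have h1 : m = Multiset.toFinsupp (L : Multiset (Ed p)) := by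
      rw [hLm, Finsupp.toMultiset_toFinsupp]
    have h2 : ∀ l : List (Ed p), Multiset.toFinsupp (l : Multiset (Ed p))
        = ∑ i : Fin l.length, Finsupp.single (l.get i) 1 := by
      intro l
      induction l with
      | nil => simp
      | cons x l ih =>
        have : ((x :: l : List (Ed p)) : Multiset (Ed p)) = {x} + (l : Multiset (Ed p)) := rfl
        rw [this, map_add, Multiset.toFinsupp_singleton, ih]
        exact (Fin.sum_univ_succ (fun i : Fin (x :: l).length =>
          Finsupp.single ((x :: l).get i) 1)).symm
    rw [h1, h2]
    unfold emon
    refine Finset.sum_congr rfl fun i _ => ?_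
    rw [← hrep i]
    simp [G]

theorem eq_of_Rc_eq {N p : ℕ} (hp : 2 * N ≤ p) {P Q : MvPolynomial (Ed p) ℝ} (hP : InvP P)
    (hQ : InvP Q) (hPd : P.totalDegree ≤ N) (hQd : Q.totalDegree ≤ N)
    (h : Rc hp P = Rc hp Q) : P = Q := by
  ext m
  by_cases hm : m.sum (fun _ k => k) ≤ N
  · obtain ⟨G, φ, h', hφ, hG, hne, rfl⟩ := exists_graph_of_mon m
    have hgood : G.ne ≤ N ∧ NoIsolated G := ⟨by omega, hG⟩
    have h2 := congrFun h G
    rw [Rc, Rc, dif_pos hgood, dif_pos hgood] at h2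
    rw [hP.coeff' G φ _ hφ (Fin.castLE_injective (nv_le_p hp hgood)) _
      (fun e he => G.noLoop e (Fin.castLE_injective _ he)), h2]
    exact hQ.coeff' _ _ _ (Fin.castLE_injective _) hφ _ _
  · push Not at hm
    rw [MvPolynomial.coeff_eq_zero_of_totalDegree_lt (lt_of_le_of_lt hPd hm),
      MvPolynomial.coeff_eq_zero_of_totalDegree_lt (lt_of_le_of_lt hQd hm)]

theorem exists_coeffs_of_inv {N p : ℕ} (hp0 : 0 < p) (hp : 2 * N ≤ p) (P : MvPolynomial (Ed p) ℝ)
    (hP : InvP P) (hPd : P.totalDegree ≤ N) : ∃ a, GoodCoeffs N a ∧ PhiP N p a = P := by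
  let L : goodV N →ₗ[ℝ] goodV N :=
    { toFun := fun a => ⟨Rc hp (PhiP N p a.1), Rc_good hp (PhiP_inv N p a.1)⟩
      map_add' := by
        intro a b
        apply Subtype.ext
        funext G
        change Rc hp (PhiP N p (a.1 + b.1)) G = Rc hp (PhiP N p a.1) G + Rc hp (PhiP N p b.1) G
        unfold Rc
        split_ifs <;> simp
      map_smul' := by
        intro c a
        apply Subtype.ext
        funext G
        change Rc hp (PhiP N p (c • a.1)) G = c * Rc hp (PhiP N p a.1) G
        unfold Rc
        split_ifs <;> simp }
  have hinj : Function.Injective L := by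
    rw [injective_iff_map_eq_zero]
    intro a ha
    apply Subtype.ext
    have h1 : Rc hp (PhiP N p a.1) = 0 := congrArg Subtype.val ha
    refine PhiP_inj hp0 hp a.2 (eq_of_Rc_eq hp (PhiP_inv N p a.1) (fun σ => map_zero _)
      (PhiP_deg N p a.1) (by simp) (h1.trans ?_))
    funext G
    unfold Rc
    split_ifs <;> simp
  obtain ⟨a, ha⟩ := LinearMap.surjective_of_injective hinj ⟨Rc hp P, Rc_good hp hP⟩
  refine ⟨a.1, a.2, eq_of_Rc_eq hp (PhiP_inv N p a.1) hP (PhiP_deg N p a.1) hPd ?_⟩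
  exact congrArg Subtype.val ha


/-! ### Functions on the cube that are polynomial along segments -/

theorem eval_smul_homog {σ : Type} {φ : MvPolynomial σ ℝ} {n : ℕ} (h : φ.IsHomogeneous n)
    (t : ℝ) (c : σ → ℝ) :
    MvPolynomial.eval (fun i => t * c i) φ = t ^ n * MvPolynomial.eval c φ := by
  rw [MvPolynomial.eval_eq, MvPolynomial.eval_eq, Finset.mul_sum]
  refine Finset.sum_congr rfl fun d hd => ?_
  have h1 := h (MvPolynomial.mem_support_iff.1 hd)
  have h2 : ∑ i ∈ d.support, d i = n := by
    rw [← h1, Finsupp.weight_apply]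
    simp [Finsupp.sum]
  simp only [mul_pow]
  rw [Finset.prod_mul_distrib, Finset.prod_pow_eq_pow_sum, h2]
  ring

theorem sep_poly_zero {ι : Type} [Fintype ι] (N : ℕ) (ν : Fin (N + 1) → ℝ)
    (hν : Function.Injective ν) (hν01 : ∀ k, ν k ∈ Set.Icc (0:ℝ) 1) (u : (ι → ℝ) → ℝ)
    (hsep : ∀ x : ι → ℝ, (∀ i, x i ∈ Set.Icc (0:ℝ) 1) → ∀ i, ∃ q : Polynomial ℝ,
      q.natDegree ≤ N ∧ ∀ s ∈ Set.Icc (0:ℝ) 1, u (Function.update x i s) = q.eval s)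
    (hgrid : ∀ κ : ι → Fin (N + 1), u (fun i => ν (κ i)) = 0) (S : Finset ι) :
    ∀ x : ι → ℝ, (∀ i, x i ∈ Set.Icc (0:ℝ) 1) → (∀ i, i ∉ S → x i ∈ Set.range ν) → u x = 0 := by
  induction S using Finset.induction_on with
  | empty =>
    intro x hx hS
    have : ∀ i, ∃ k, ν k = x i := fun i => hS i (by simp)
    choose κ hκ using this
    have := hgrid κ
    simp only [hκ] at this
    exact this
  | insert i S hi ih =>
    intro x hx hS
    obtain ⟨q, hq, hqe⟩ := hsep x hx i
    have hq0 : q = 0 := by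
      refine Polynomial.eq_zero_of_degree_lt_of_eval_index_eq_zero (v := ν) Finset.univ
        (hν.injOn) ?_ (fun k _ => ?_)
      · refine lt_of_le_of_lt Polynomial.degree_le_natDegree ?_
        simp only [Finset.card_univ, Fintype.card_fin]
        exact_mod_cast Nat.lt_succ_of_le hq
      · rw [← hqe _ (hν01 k)]
        apply ih
        · intro j
          by_cases hj : j = i
          · subst hj; simpa using hν01 k
          · simpa [hj] using hx j
        · intro j hj
          by_cases hji : j = i
          · subst hji; simp
          · simpa [hji] using hS j (by simp [hji, hj])
    have := hqe (x i) (hx i)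
    simpa [hq0] using this

theorem exists_mvpoly {ι : Type} [Fintype ι] (N : ℕ) (h : (ι → ℝ) → ℝ)
    (hseg : ∀ x y : ι → ℝ, (∀ i, x i ∈ Set.Icc (0:ℝ) 1) → (∀ i, y i ∈ Set.Icc (0:ℝ) 1) →
      ∃ q : Polynomial ℝ, q.natDegree ≤ N ∧ ∀ t ∈ Set.Icc (0:ℝ) 1,
        h (fun i => x i + t * (y i - x i)) = q.eval t) :
    ∃ P : MvPolynomial ι ℝ, P.totalDegree ≤ N ∧
      ∀ x : ι → ℝ, (∀ i, x i ∈ Set.Icc (0:ℝ) 1) → MvPolynomial.eval x P = h x := by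
  let ν : Fin (N + 1) → ℝ := fun k => ((k:ℕ):ℝ) / (N + 1)
  have hN : (0:ℝ) < (N:ℝ) + 1 := by positivity
  have hν : Function.Injective ν := by
    intro a b hab
    simp only [ν] at hab
    rw [div_left_inj' hN.ne'] at hab
    exact Fin.ext (by exact_mod_cast hab)
  have hν01 : ∀ k, ν k ∈ Set.Icc (0:ℝ) 1 := by
    intro k
    refine ⟨by positivity, ?_⟩
    simp only [ν]
    rw [div_le_one hN]
    have := k.2
    exact_mod_cast this.le
  let B : Fin (N + 1) → Polynomial ℝ := fun k => Lagrange.basis Finset.univ ν k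
  have hBdeg : ∀ k, (B k).natDegree ≤ N := by
    intro k
    simp only [B]
    rw [Lagrange.natDegree_basis hν.injOn (Finset.mem_univ k)]
    simp
  have hB : ∀ k l, (B k).eval (ν l) = if k = l then 1 else 0 := by
    intro k l
    split_ifs with hkl
    · subst hkl
      exact Lagrange.eval_basis_self hν.injOn (Finset.mem_univ k)
    · exact Lagrange.eval_basis_of_ne hkl (Finset.mem_univ l)
  let P : MvPolynomial ι ℝ := ∑ κ : ι → Fin (N + 1),
    MvPolynomial.C (h (fun i => ν (κ i))) * ∏ i, Polynomial.aeval (MvPolynomial.X i) (B (κ i))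
  have hPe : ∀ x : ι → ℝ, MvPolynomial.eval x P = ∑ κ : ι → Fin (N + 1),
      h (fun i => ν (κ i)) * ∏ i, (B (κ i)).eval (x i) := by
    intro x
    simp only [P, map_sum, map_mul, map_prod, MvPolynomial.eval_C]
    refine Finset.sum_congr rfl fun κ _ => ?_
    congr 1
    refine Finset.prod_congr rfl fun i _ => ?_
    have := Polynomial.hom_eval₂ (B (κ i)) (algebraMap ℝ (MvPolynomial ι ℝ))
      (MvPolynomial.eval x) (MvPolynomial.X i)
    rw [Polynomial.aeval_def, this, MvPolynomial.eval_X]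
    have h2 : (MvPolynomial.eval x).comp (algebraMap ℝ (MvPolynomial ι ℝ)) = RingHom.id ℝ := by
      ext r
      simp [MvPolynomial.algebraMap_eq]
    rw [h2, Polynomial.eval₂_id]
  have hPh : ∀ x : ι → ℝ, (∀ i, x i ∈ Set.Icc (0:ℝ) 1) → MvPolynomial.eval x P = h x := by
    intro x hx
    rw [eq_comm, ← sub_eq_zero]
    refine sep_poly_zero N ν hν hν01 (fun x => h x - MvPolynomial.eval x P) ?_ ?_ Finset.univ x hx
      (by simp)
    · intro x hx i
      obtain ⟨q, hq, hqe⟩ := hseg (Function.update x i 0) (Function.update x i 1)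
        (fun j => by by_cases hj : j = i
                     · subst hj; simp
                     · simpa [hj] using hx j)
        (fun j => by by_cases hj : j = i
                     · subst hj; simp
                     · simpa [hj] using hx j)
      let r : Polynomial ℝ := ∑ κ : ι → Fin (N + 1),
        Polynomial.C (h (fun i => ν (κ i)) * ∏ j ∈ Finset.univ.erase i, (B (κ j)).eval (x j))
          * B (κ i)
      refine ⟨q - r, ?_, fun s hs => ?_⟩
      · refine (Polynomial.natDegree_sub_le _ _).trans (max_le hq ?_)
        refine Polynomial.natDegree_sum_le_of_forall_le _ _ fun κ _ => ?_
        exact (Polynomial.natDegree_C_mul_le _ _).trans (hBdeg _)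
      · rw [Polynomial.eval_sub, ← hqe s hs]
        congr 1
        · congr 1
          funext j
          by_cases hj : j = i
          · subst hj; simp
          · simp [hj]
        · rw [hPe]
          simp only [r, Polynomial.eval_finsetSum, Polynomial.eval_mul, Polynomial.eval_C]
          refine Finset.sum_congr rfl fun κ _ => ?_
          rw [← Finset.prod_erase_mul _ _ (Finset.mem_univ i), mul_assoc]
          congr 1
          congr 1
          · refine Finset.prod_congr rfl fun j hj => ?_
            rw [Function.update_of_ne (Finset.ne_of_mem_erase hj)]
          · simp
    · intro κ
      rw [hPe, Finset.sum_eq_single κ]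
      · simp [hB]
      · intro κ' _ hne
        obtain ⟨i, hi⟩ := Function.ne_iff.1 hne
        rw [Finset.prod_eq_zero (Finset.mem_univ i), mul_zero]
        rw [hB, if_neg hi]
      · simp
  refine ⟨P, ?_, hPh⟩
  have hcomp : ∀ k, N < k → MvPolynomial.homogeneousComponent k P = 0 := by
    intro k hk
    refine mvpoly_zero_of_cube _ fun c hc => ?_
    obtain ⟨q, hq, hqe⟩ := hseg 0 c (fun i => by simp) hc
    let r : Polynomial ℝ := ∑ k ∈ Finset.range (P.totalDegree + 1),
      Polynomial.C (MvPolynomial.eval c (MvPolynomial.homogeneousComponent k P)) * Polynomial.X ^ k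
    have hrq : r = q := by
      refine Polynomial.eq_of_infinite_eval_eq _ _
        ((Set.Icc_infinite (zero_lt_one' ℝ)).mono fun t ht => ?_)
      simp only [Set.mem_ofPred_eq]
      rw [← hqe t ht]
      simp only [Pi.zero_apply, zero_add, sub_zero]
      rw [← hPh _ (fun i => ⟨mul_nonneg ht.1 (hc i).1, mul_le_one₀ ht.2 (hc i).1 (hc i).2⟩)]
      conv_rhs => rw [← MvPolynomial.sum_homogeneousComponent P]
      rw [map_sum]
      simp only [r, Polynomial.eval_finsetSum, Polynomial.eval_mul, Polynomial.eval_C,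
        Polynomial.eval_pow, Polynomial.eval_X]
      refine Finset.sum_congr rfl fun k _ => ?_
      rw [eval_smul_homog (MvPolynomial.homogeneousComponent_isHomogeneous k P), mul_comm]
    have h1 := congrArg (fun s => Polynomial.coeff s k) hrq
    simp only [r, Polynomial.finsetSum_coeff, Polynomial.coeff_C_mul_X_pow] at h1
    rw [Polynomial.coeff_eq_zero_of_natDegree_lt (lt_of_le_of_lt hq hk)] at h1
    by_cases hkd : k ∈ Finset.range (P.totalDegree + 1)
    · rw [Finset.sum_eq_single k (fun b _ hb => by rw [if_neg (Ne.symm hb)]) (fun h => absurd hkd h)]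
        at h1
      simpa using h1
    · rw [MvPolynomial.homogeneousComponent_eq_zero _ _ (by simpa using hkd)]
      simp
  by_contra hc
  push Not at hc
  obtain ⟨d, hd, hdeg⟩ : ∃ d ∈ P.support, N < d.degree := by
    by_contra hcc
    push Not at hcc
    exact absurd (Finset.sup_le fun d hd => by
      have := hcc d hd
      rw [Finsupp.degree_apply] at this
      exact this) (not_le.2 hc)
  have h1 := congrArg (MvPolynomial.coeff d) (hcomp _ hdeg)
  rw [MvPolynomial.coeff_homogeneousComponent, if_pos rfl] at h1
  exact MvPolynomial.mem_support_iff.1 hd (by simpa using h1)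

/-! ### Vanishing derivatives imply polynomial along segments -/

theorem convex_graphons : Convex ℝ Graphons := by
  intro f hf g hg a b ha hb hab
  refine ⟨⟨?_, fun x y => ?_⟩, fun x y => ?_⟩
  · exact (hf.1.1.const_mul a).add (hg.1.1.const_mul b)
  · simp only [Pi.add_apply, Pi.smul_apply, hf.1.2 x y, hg.1.2 x y]
  · have h1 := hf.2 x y
    have h2 := hg.2 x y
    simp only [Pi.add_apply, Pi.smul_apply, smul_eq_mul]
    exact (convex_Icc (0:ℝ) 1) h1 h2 ha hb hab

theorem GDiffN.tend {U : Set Kern} {F : Kern → ℝ} {M : ℕ} (h : GDiffN U F M) {n : ℕ} (hn : n < M) :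
    ∀ f ∈ U, ∀ g : Fin (n+1) → Kern, (∀ i, g i ∈ adm U f) →
        Tendsto
          (fun t : ℝ => (gD U F n (f + t • g (Fin.last n)) (fun i => g i.castSucc)
              - gD U F n f (fun i => g i.castSucc)) / t)
          (nhdsWithin (0:ℝ) {t : ℝ | t ≠ 0 ∧ f + t • g (Fin.last n) ∈ U})
          (nhds (gD U F (n+1) f g)) := by
  induction M with
  | zero => omega
  | succ M ih =>
    rcases Nat.lt_succ_iff_lt_or_eq.1 hn with h1 | h1
    · exact ih h.1 h1
    · subst h1
      exact h.2

theorem exists_antideriv (q : Polynomial ℝ) : ∃ Q : Polynomial ℝ,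
    Q.natDegree ≤ q.natDegree + 1 ∧ Polynomial.derivative Q = q := by
  refine ⟨∑ i ∈ Finset.range (q.natDegree + 1),
    Polynomial.C (q.coeff i / (i + 1)) * Polynomial.X ^ (i + 1), ?_, ?_⟩
  · refine Polynomial.natDegree_sum_le_of_forall_le _ _ fun i hi => ?_
    refine (Polynomial.natDegree_C_mul_X_pow_le _ _).trans ?_
    have := Finset.mem_range.1 hi
    omega
  · conv_rhs => rw [q.as_sum_range_C_mul_X_pow]
    rw [Polynomial.derivative_sum]
    refine Finset.sum_congr rfl fun i _ => ?_
    rw [Polynomial.derivative_C_mul_X_pow]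
    congr 2
    push_cast
    field_simp

theorem poly_of_deriv (u : ℝ → ℝ) (q : Polynomial ℝ)
    (h : ∀ x ∈ Set.Ioo (0:ℝ) 1, HasDerivAt u (q.eval x) x) (Q : Polynomial ℝ)
    (hQ : Polynomial.derivative Q = q) :
    ∃ c : ℝ, ∀ x ∈ Set.Ioo (0:ℝ) 1, u x = (Q + Polynomial.C c).eval x := by
  have hd : ∀ x ∈ Set.Ioo (0:ℝ) 1, HasDerivAt (fun x => u x - Q.eval x) 0 x := by
    intro x hx
    have := (h x hx).sub (Q.hasDerivAt x)
    rw [hQ, sub_self] at this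
    exact this
  refine ⟨u (1/2) - Q.eval (1/2), fun x hx => ?_⟩
  have := IsOpen.is_const_of_deriv_eq_zero (isOpen_Ioo (a := (0:ℝ)) (b := 1))
    (isPreconnected_Ioo) (f := fun x => u x - Q.eval x)
    (fun y hy => (hd y hy).differentiableAt.differentiableWithinAt)
    (fun y hy => (hd y hy).deriv) hx (show (1/2:ℝ) ∈ Set.Ioo (0:ℝ) 1 by norm_num)
  rw [Polynomial.eval_add, Polynomial.eval_C]
  linarith

theorem l1Dist_le_const {f g : Kern} {C : ℝ} (h : ∀ x y, |f x y - g x y| ≤ C) :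
    l1Dist f g ≤ C := by
  have h1 : ∀ x, ‖∫ y, |f x y - g x y| ∂μ01‖ ≤ C := by
    intro x
    have := norm_integral_le_of_norm_le_const (μ := μ01) (f := fun y => |f x y - g x y|) (C := C)
      (Filter.Eventually.of_forall fun y => by simpa using h x y)
    simpa using this
  have := norm_integral_le_of_norm_le_const (μ := μ01)
    (f := fun x => ∫ y, |f x y - g x y| ∂μ01) (C := C)
    (Filter.Eventually.of_forall h1)
  have h2 : ‖l1Dist f g‖ ≤ C := by
    unfold l1Dist
    refine this.trans (by simp)
  exact (le_abs_self _).trans h2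

theorem seg_mem {f g : Kern} (hf : f ∈ Graphons) (hg : g ∈ Graphons) {t : ℝ}
    (ht : t ∈ Set.Icc (0:ℝ) 1) : f + t • (g - f) ∈ Graphons :=
  convex_graphons.add_smul_sub_mem hf hg ht

theorem seg_poly {N : ℕ} {F : Kern → ℝ} (hL1 : L1ContOn F) (hdiff : GDiffN Graphons F (N + 1))
    (hz : ∀ f ∈ Graphons, ∀ g : Fin (N + 1) → Kern, (∀ i, g i ∈ adm Graphons f) →
        gD Graphons F (N + 1) f g = 0) {f g : Kern} (hf : f ∈ Graphons) (hg : g ∈ Graphons) :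
    ∃ q : Polynomial ℝ, q.natDegree ≤ N ∧
      ∀ t ∈ Set.Icc (0:ℝ) 1, F (f + t • (g - f)) = q.eval t := by
  set v : Kern := g - f with hv
  let h : ℕ → ℝ → ℝ := fun k s => gD Graphons F k (f + s • v) (fun _ => v)
  have hadm : ∀ s ∈ Set.Ioo (0:ℝ) 1, v ∈ adm Graphons (f + s • v) := by
    intro s hs
    refine ⟨1 - s, by linarith [hs.2], by linarith [hs.1], fun ε h0 h1 => ?_⟩
    rw [add_assoc, ← add_smul]
    exact seg_mem hf hg ⟨by linarith [hs.1], by linarith⟩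
  have hder : ∀ k ≤ N, ∀ s ∈ Set.Ioo (0:ℝ) 1, HasDerivAt (h k) (h (k+1) s) s := by
    intro k hk s hs
    rw [hasDerivAt_iff_tendsto_slope_zero]
    have h1 := hdiff.tend (Nat.lt_succ_of_le hk) (f + s • v)
      (seg_mem hf hg ⟨hs.1.le, hs.2.le⟩) (fun _ => v) (fun _ => hadm s hs)
    have hmem : {t : ℝ | t ≠ 0 ∧ f + s • v + t • v ∈ Graphons} ∈ 𝓝[≠] (0:ℝ) := by
      have hI : Set.Ioo (-s) (1 - s) ∈ 𝓝 (0:ℝ) :=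
        Ioo_mem_nhds (by linarith [hs.1]) (by linarith [hs.2])
      filter_upwards [self_mem_nhdsWithin, nhdsWithin_le_nhds hI] with t ht0 ht
      refine ⟨ht0, ?_⟩
      rw [add_assoc, ← add_smul]
      exact seg_mem hf hg ⟨by linarith [ht.1], by linarith [ht.2]⟩
    have h2 := h1.mono_left (nhdsWithin_le_of_mem hmem)
    refine h2.congr fun t => ?_
    simp only [h]
    rw [add_assoc, ← add_smul, smul_eq_mul, div_eq_inv_mul]
  have hpoly : ∀ j ≤ N, ∃ q : Polynomial ℝ, q.natDegree ≤ j ∧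
      ∀ s ∈ Set.Ioo (0:ℝ) 1, h (N - j) s = q.eval s := by
    intro j
    induction j with
    | zero =>
      intro _
      obtain ⟨c, hc⟩ := poly_of_deriv (h N) 0 (fun s hs => by
        have h1 := hder N le_rfl s hs
        have h2 : h (N+1) s = 0 :=
          hz _ (seg_mem hf hg ⟨hs.1.le, hs.2.le⟩) _ (fun _ => hadm s hs)
        rw [h2] at h1
        simpa using h1) 0 (by simp)
      exact ⟨0 + Polynomial.C c, by simp, by simpa using hc⟩
    | succ j ih =>
      intro hj
      obtain ⟨q, hq, hqe⟩ := ih (by omega)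
      obtain ⟨Q, hQd, hQ⟩ := exists_antideriv q
      obtain ⟨c, hc⟩ := poly_of_deriv (h (N - (j+1))) q (fun s hs => by
        have h1 := hder (N - (j+1)) (by omega) s hs
        rw [show N - (j+1) + 1 = N - j by omega, hqe s hs] at h1
        exact h1) Q hQ
      refine ⟨Q + Polynomial.C c, ?_, hc⟩
      rw [Polynomial.natDegree_add_C]
      omega
  obtain ⟨q, hq, hqe⟩ := hpoly N le_rfl
  refine ⟨q, hq, ?_⟩
  have hcont : ContinuousOn (fun t : ℝ => F (f + t • v)) (Set.Icc 0 1) := by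
    rw [Metric.continuousOn_iff]
    intro t ht ε hε
    obtain ⟨δ, hδ, hd⟩ := hL1 _ (seg_mem hf hg ht) ε hε
    refine ⟨δ, hδ, fun s hs hst => ?_⟩
    rw [dist_comm, Real.dist_eq]
    refine hd _ (seg_mem hf hg hs) (lt_of_le_of_lt (l1Dist_le_const (C := |t - s|) ?_) ?_)
    · intro x y
      simp only [Pi.add_apply, Pi.smul_apply, smul_eq_mul, hv, Pi.sub_apply]
      have e1 : f x y + t * (g x y - f x y) - (f x y + s * (g x y - f x y))
          = (t - s) * (g x y - f x y) := by ring
      rw [e1, abs_mul]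
      have h1 := hf.2 x y
      have h2 := hg.2 x y
      have : |g x y - f x y| ≤ 1 := abs_le.2 ⟨by linarith [h1.2, h2.1], by linarith [h1.1, h2.2]⟩
      exact mul_le_of_le_one_right (abs_nonneg _) this
    · rw [dist_comm, Real.dist_eq] at hst
      exact hst
  have hEq : Set.EqOn (fun t : ℝ => F (f + t • v)) (fun t => q.eval t) (Set.Ioo 0 1) := by
    intro s hs
    have := hqe s hs
    rw [Nat.sub_self] at this
    exact this
  have := hEq.of_subset_closure hcont q.continuous.continuousOn Set.Ioo_subset_Icc_self
    (by rw [closure_Ioo (by norm_num)])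
  exact this


/-! ### `L¹` continuity of homomorphism densities and density of step graphons -/

instance : IsProbabilityMeasure μ01 := isProb_mu01

theorem l1Dist_eq_prod {f g : Kern} (hf : f ∈ Graphons) (hg : g ∈ Graphons) :
    l1Dist f g = ∫ z : ℝ × ℝ, |f z.1 z.2 - g z.1 z.2| ∂(μ01.prod μ01) := by
  unfold l1Dist
  rw [integral_prod]
  refine Integrable.of_bound (C := 1) ((hf.1.1.sub hg.1.1).abs.aestronglyMeasurable) ?_
  refine Filter.Eventually.of_forall fun z => ?_
  have h1 := hf.2 z.1 z.2
  have h2 := hg.2 z.1 z.2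
  rw [Real.norm_eq_abs, abs_abs]
  exact abs_le.2 ⟨by linarith [h1.1, h2.2], by linarith [h1.2, h2.1]⟩

theorem map_pair_pi {n : ℕ} {i j : Fin n} (hij : i ≠ j) :
    MeasurePreserving (fun x : Fin n → ℝ => (x i, x j)) (Measure.pi fun _ => μ01)
      (μ01.prod μ01) := by
  refine ⟨by fun_prop, ?_⟩
  have h := ProbabilityTheory.iIndepFun_pi (μ := fun _ : Fin n => μ01)
    (X := fun _ : Fin n => (id : ℝ → ℝ)) (fun _ => aemeasurable_id)
  have h2 := (h.indepFun hij)
  have h3 := (ProbabilityTheory.indepFun_iff_map_prod_eq_prod_map_map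
    (measurable_pi_apply i).aemeasurable (measurable_pi_apply j).aemeasurable).1 h2
  change Measure.map (fun x : Fin n → ℝ => (x i, x j)) _ = _ at h3
  rw [h3]
  congr 1
  · exact (measurePreserving_eval (fun _ : Fin n => μ01) i).map_eq
  · exact (measurePreserving_eval (fun _ : Fin n => μ01) j).map_eq

theorem abs_prod_sub_prod {ι : Type} (s : Finset ι) (u v : ι → ℝ)
    (hu : ∀ i, u i ∈ Set.Icc (0:ℝ) 1) (hv : ∀ i, v i ∈ Set.Icc (0:ℝ) 1) :
    |∏ i ∈ s, u i - ∏ i ∈ s, v i| ≤ ∑ i ∈ s, |u i - v i| := by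
  induction s using Finset.induction_on with
  | empty => simp
  | insert i s hi ih =>
    rw [Finset.prod_insert hi, Finset.prod_insert hi, Finset.sum_insert hi]
    have e : u i * ∏ i ∈ s, u i - v i * ∏ i ∈ s, v i
        = (u i - v i) * ∏ i ∈ s, u i + v i * (∏ i ∈ s, u i - ∏ i ∈ s, v i) := by ring
    rw [e]
    refine (abs_add_le _ _).trans (add_le_add ?_ ?_)
    · rw [abs_mul]
      refine mul_le_of_le_one_right (abs_nonneg _) ?_
      rw [abs_of_nonneg (Finset.prod_nonneg fun i _ => (hu i).1)]
      exact Finset.prod_le_one (fun i _ => (hu i).1) (fun i _ => (hu i).2)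
    · rw [abs_mul, abs_of_nonneg (hv i).1]
      exact (mul_le_of_le_one_left (abs_nonneg _) (hv i).2).trans ih

theorem hom_measurable {f : Kern} (hf : Measurable (Function.uncurry f)) {n : ℕ} (i j : Fin n) :
    Measurable (fun x : Fin n → ℝ => f (x i) (x j)) := by
  have := hf.comp ((measurable_pi_apply (X := fun _ : Fin n => ℝ) i).prodMk (measurable_pi_apply j))
  exact this

theorem hom_lip (G : MG) {f g : Kern} (hf : f ∈ Graphons) (hg : g ∈ Graphons) :
    |homDensity G f - homDensity G g| ≤ G.ne * l1Dist f g := by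
  have hInt : ∀ {f : Kern}, f ∈ Graphons → Integrable (fun x : Fin G.nv → ℝ =>
      ∏ e : Fin G.ne, f (x (G.s e)) (x (G.t e))) (Measure.pi fun _ => μ01) := by
    intro f hf
    refine Integrable.of_bound (C := 1) (Measurable.aestronglyMeasurable
      (Finset.measurable_prod _ fun e _ => hom_measurable hf.1.1 _ _)) ?_
    refine Filter.Eventually.of_forall fun z => ?_
    rw [Real.norm_eq_abs, abs_of_nonneg (Finset.prod_nonneg fun i _ => (hf.2 _ _).1)]
    exact Finset.prod_le_one (fun i _ => (hf.2 _ _).1) (fun i _ => (hf.2 _ _).2)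
  have hinte : ∀ e, Integrable (fun x : Fin G.nv → ℝ =>
      |f (x (G.s e)) (x (G.t e)) - g (x (G.s e)) (x (G.t e))|) (Measure.pi fun _ => μ01) := by
    intro e
    refine Integrable.of_bound (C := 1) (Measurable.aestronglyMeasurable
      (((hom_measurable hf.1.1 _ _).sub (hom_measurable hg.1.1 _ _)).abs)) ?_
    refine Filter.Eventually.of_forall fun z => ?_
    have h1 := hf.2 (z (G.s e)) (z (G.t e))
    have h2 := hg.2 (z (G.s e)) (z (G.t e))
    rw [Real.norm_eq_abs, abs_abs]
    exact abs_le.2 ⟨by linarith [h1.1, h2.2], by linarith [h1.2, h2.1]⟩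
  unfold homDensity
  rw [← integral_sub (hInt hf) (hInt hg)]
  refine (abs_integral_le_integral_abs).trans ?_
  calc _ ≤ ∫ x : Fin G.nv → ℝ, ∑ e : Fin G.ne,
          |f (x (G.s e)) (x (G.t e)) - g (x (G.s e)) (x (G.t e))| ∂(Measure.pi fun _ => μ01) := by
        refine integral_mono ((hInt hf).sub (hInt hg)).abs
          (integrable_finsetSum _ fun e _ => hinte e) fun x => ?_
        exact abs_prod_sub_prod _ _ _ (fun e => hf.2 _ _) (fun e => hg.2 _ _)
    _ = ∑ e : Fin G.ne, l1Dist f g := by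
        rw [integral_finsetSum _ fun e _ => hinte e]
        refine Finset.sum_congr rfl fun e _ => ?_
        rw [l1Dist_eq_prod hf hg, ← (map_pair_pi (G.noLoop e)).map_eq, integral_map]
        · exact (map_pair_pi (G.noLoop e)).measurable.aemeasurable
        · exact (hf.1.1.sub hg.1.1).abs.aestronglyMeasurable
    _ = G.ne * l1Dist f g := by simp

theorem kap_dist (p : ℕ) [NeZero p] {x : ℝ} (hx : x ∈ Set.Icc (0:ℝ) 1) :
    |x - ((kap p x : ℕ) : ℝ) / p| ≤ 1 / p := by
  have hp : (0:ℝ) < p := by exact_mod_cast NeZero.pos p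
  have hp1 : 1 ≤ p := NeZero.pos p
  have hnn : 0 ≤ (p:ℝ) * x := mul_nonneg hp.le hx.1
  have h1 : ((kap p x : ℕ):ℝ) ≤ p * x := by
    refine le_trans ?_ (Nat.floor_le hnn)
    simp only [kap]
    exact_mod_cast min_le_left _ _
  have h2 : (p:ℝ) * x ≤ (kap p x : ℕ) + 1 := by
    simp only [kap]
    rcases le_total ⌊(p:ℝ) * x⌋₊ (p - 1) with h | h
    · rw [min_eq_left h]; exact (Nat.lt_floor_add_one _).le
    · rw [min_eq_right h]
      push_cast [hp1]
      nlinarith [hx.2]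
  have e : x - ((kap p x : ℕ) : ℝ) / p = (p * x - (kap p x : ℕ)) / p := by field_simp
  rw [e, abs_div, abs_of_pos hp]
  gcongr
  exact abs_le.2 ⟨by linarith, by linarith⟩

theorem measurableSet_diag (p : ℕ) [NeZero p] :
    MeasurableSet {z : ℝ × ℝ | kap p z.1 = kap p z.2} :=
  measurableSet_eq_fun ((measurable_kap p).comp measurable_fst)
    ((measurable_kap p).comp measurable_snd)

theorem diag_measure (p : ℕ) [NeZero p] :
    (μ01.prod μ01) {z : ℝ × ℝ | kap p z.1 = kap p z.2} = (p : ℝ≥0∞)⁻¹ := by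
  rw [Measure.prod_apply (measurableSet_diag p)]
  have : ∀ x, μ01 (Prod.mk x ⁻¹' {z : ℝ × ℝ | kap p z.1 = kap p z.2}) = (p : ℝ≥0∞)⁻¹ := by
    intro x
    have h := (unif_kap p).2 (kap p x)
    rw [Fintype.card_fin] at h
    rw [← h]
    congr 1
    ext y
    simp [eq_comm]
  rw [lintegral_congr this]
  simp

theorem clip_close {a b : ℝ} (ha : a ∈ Set.Icc (0:ℝ) 1) : |a - max 0 (min 1 b)| ≤ |a - b| := by
  have := abs_max_sub_max_le_max 0 a 0 (min 1 b)
  have e1 : max 0 a = a := max_eq_right ha.1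
  have := abs_min_sub_min_le_max 1 a 1 b
  have e2 : min 1 a = a := min_eq_right ha.2
  simp_all
  exact le_trans (by assumption) (by assumption)

theorem dense_step {f : Kern} (hf : f ∈ Graphons) (p0 : ℕ) (hp0 : 0 < p0) {ε : ℝ} (hε : 0 < ε) :
    ∃ k : ℕ, 0 < k ∧ ∀ _ : NeZero (p0 * k), ∃ c : Ed (p0 * k) → ℝ,
      (∀ i, c i ∈ Set.Icc (0:ℝ) 1) ∧ l1Dist f (stepK (kap (p0 * k)) (extC c)) < ε := by
  set ρ := μ01.prod μ01 with hρ
  have hfi : Integrable (Function.uncurry f) ρ := by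
    refine Integrable.of_bound (C := 1) hf.1.1.aestronglyMeasurable ?_
    refine Filter.Eventually.of_forall fun z => ?_
    have := hf.2 z.1 z.2
    rw [Real.norm_eq_abs]
    exact abs_le.2 ⟨by simp only [Function.uncurry]; linarith [this.1], this.2⟩
  obtain ⟨φ, hφs, hφd, hφc, hφi⟩ := hfi.exists_hasCompactSupport_integral_sub_le
    (show 0 < ε / 4 by positivity)
  let ψ : ℝ × ℝ → ℝ := fun z => max 0 (min 1 ((φ z + φ z.swap) / 2))
  have hψ01 : ∀ z, ψ z ∈ Set.Icc (0:ℝ) 1 := fun z =>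
    ⟨le_max_left _ _, max_le zero_le_one (min_le_left _ _)⟩
  have hψs : ∀ z, ψ z.swap = ψ z := fun z => by simp only [ψ, Prod.swap_swap, add_comm]
  have huc : UniformContinuous φ := hφs.uniformContinuous_of_continuous hφc
  obtain ⟨δ, hδ, hδu⟩ := Metric.uniformContinuous_iff.1 huc (ε / 4) (by positivity)
  obtain ⟨k, hk⟩ := exists_nat_gt (max (1 / δ) (4 / ε))
  have hk0 : 0 < k := by
    have : (0:ℝ) < k := lt_of_le_of_lt (le_max_of_le_left (by positivity)) hk
    exact_mod_cast this
  refine ⟨k, hk0, fun _ => ?_⟩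
  set p := p0 * k with hp
  have hpk : (k:ℝ) ≤ p := by
    have : k ≤ p := Nat.le_mul_of_pos_left k hp0
    exact_mod_cast this
  have hp' : max (1 / δ) (4 / ε) < (p:ℝ) := lt_of_lt_of_le hk hpk
  have hpp : (0:ℝ) < p := lt_of_le_of_lt (le_max_of_le_left (by positivity)) hp'
  have hpδ : 1 / (p:ℝ) < δ := by
    rw [div_lt_comm₀ hpp hδ]
    exact lt_of_le_of_lt (le_max_left _ _) hp'
  have hpε : 1 / (p:ℝ) < ε / 4 := by
    rw [div_lt_comm₀ hpp (by positivity), one_div_div]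
    exact lt_of_le_of_lt (le_max_right _ _) hp'
  let w : Fin p → ℝ := fun a => ((a:ℕ):ℝ) / p
  let c : Ed p → ℝ := fun z => Sym2.lift ⟨fun a b => ψ (w a, w b), fun a b => (hψs (w b, w a))⟩ z.1
  have hc : ∀ i, c i ∈ Set.Icc (0:ℝ) 1 := by
    rintro ⟨z, hz⟩
    induction z with
    | h a b => exact hψ01 _
  refine ⟨c, hc, ?_⟩
  have hcg := extC_graphon c hc
  rw [l1Dist_eq_prod hf hcg]
  have hψf : ∀ z : ℝ × ℝ, |f z.1 z.2 - ψ z| ≤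
      (‖Function.uncurry f z - φ z‖ + ‖Function.uncurry f z.swap - φ z.swap‖) / 2 := by
    intro z
    refine (clip_close (hf.2 z.1 z.2)).trans ?_
    have hs := hf.1.2 z.1 z.2
    have e : f z.1 z.2 - (φ z + φ z.swap) / 2
        = ((Function.uncurry f z - φ z) + (Function.uncurry f z.swap - φ z.swap)) / 2 := by
      simp only [Function.uncurry, Prod.fst_swap, Prod.snd_swap, ← hs]
      ring
    rw [e, abs_div, abs_two]
    gcongr
    exact abs_add_le _ _
  have hψu : ∀ z z' : ℝ × ℝ, dist z z' < δ → |ψ z - ψ z'| ≤ ε / 4 := by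
    intro z z' hz
    have h1 := hδu hz
    have h2 := hδu (a := z.swap) (b := z'.swap) (by
      rw [Prod.dist_eq, max_comm] at hz ⊢
      simpa [max_comm] using hz)
    rw [Real.dist_eq] at h1 h2
    have h3 := abs_max_sub_max_le_max 0 (min 1 ((φ z + φ z.swap) / 2)) 0
      (min 1 ((φ z' + φ z'.swap) / 2))
    have h4 := abs_min_sub_min_le_max 1 ((φ z + φ z.swap) / 2) 1 ((φ z' + φ z'.swap) / 2)
    simp only [sub_self, abs_zero, abs_nonneg, max_eq_right] at h3 h4
    refine (h3.trans h4).trans ?_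
    rw [abs_lt] at h1 h2
    exact abs_le.2 ⟨by linarith, by linarith⟩
  have hI1 : Integrable (fun z => ‖Function.uncurry f z - φ z‖) ρ := (hfi.sub hφi).norm
  have hsw : MeasurePreserving (Prod.swap : ℝ × ℝ → ℝ × ℝ) ρ ρ := Measure.measurePreserving_swap
  have hI2 : Integrable (fun z : ℝ × ℝ => ‖Function.uncurry f z.swap - φ z.swap‖) ρ :=
    hsw.integrable_comp_of_integrable hI1
  have hI2e : ∫ z : ℝ × ℝ, ‖Function.uncurry f z.swap - φ z.swap‖ ∂ρ
      = ∫ z, ‖Function.uncurry f z - φ z‖ ∂ρ :=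
    hsw.integral_comp (MeasurableEquiv.prodComm.measurableEmbedding)
      (fun z => ‖Function.uncurry f z - φ z‖)
  let D : Set (ℝ × ℝ) := {z : ℝ × ℝ | kap p z.1 = kap p z.2}
  have hD : MeasurableSet D := measurableSet_diag p
  have hI3 : Integrable (D.indicator (fun _ => (1:ℝ))) ρ :=
    (integrable_const 1).indicator hD
  have hbd : ∀ᵐ z ∂ρ, |f z.1 z.2 - stepK (kap p) (extC c) z.1 z.2| ≤
      (‖Function.uncurry f z - φ z‖ + ‖Function.uncurry f z.swap - φ z.swap‖) / 2 + ε / 4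
        + D.indicator (fun _ => (1:ℝ)) z := by
    have hae : ∀ᵐ z ∂ρ, z ∈ Set.Icc (0:ℝ) 1 ×ˢ Set.Icc (0:ℝ) 1 := by
      rw [hρ, Measure.prod_restrict]
      exact ae_restrict_mem (measurableSet_Icc.prod measurableSet_Icc)
    filter_upwards [hae] with z hz
    by_cases hzD : z ∈ D
    · have h1 := hf.2 z.1 z.2
      have h2 := hcg.2 z.1 z.2
      rw [Set.indicator_of_mem hzD]
      have : |f z.1 z.2 - stepK (kap p) (extC c) z.1 z.2| ≤ 1 :=
        abs_le.2 ⟨by linarith [h1.1, h2.2], by linarith [h1.2, h2.1]⟩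
      have h3 := norm_nonneg (Function.uncurry f z - φ z)
      have h4 := norm_nonneg (Function.uncurry f z.swap - φ z.swap)
      linarith
    · rw [Set.indicator_of_notMem hzD, add_zero]
      have hne : kap p z.1 ≠ kap p z.2 := hzD
      have e : stepK (kap p) (extC c) z.1 z.2 = ψ (w (kap p z.1), w (kap p z.2)) := by
        simp only [stepK, extC, hne, ne_eq, not_false_eq_true, dite_true]
        rfl
      rw [e]
      have h5 : |ψ z - ψ (w (kap p z.1), w (kap p z.2))| ≤ ε / 4 := by
        apply hψu
        rw [Prod.dist_eq, Real.dist_eq, Real.dist_eq]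
        exact max_lt (lt_of_le_of_lt (kap_dist p hz.1) hpδ) (lt_of_le_of_lt (kap_dist p hz.2) hpδ)
      have h6 := hψf z
      have h7 := abs_add_le (f z.1 z.2 - ψ z) (ψ z - ψ (w (kap p z.1), w (kap p z.2)))
      rw [sub_add_sub_cancel] at h7
      linarith
  have hI12 := (hI1.add hI2).div_const 2
  have hIall := (hI12.add (integrable_const (ε / 4))).add hI3
  calc ∫ z : ℝ × ℝ, |f z.1 z.2 - stepK (kap p) (extC c) z.1 z.2| ∂ρ
      ≤ ∫ z, ((‖Function.uncurry f z - φ z‖ + ‖Function.uncurry f z.swap - φ z.swap‖) / 2 + ε / 4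
        + D.indicator (fun _ => (1:ℝ)) z) ∂ρ := by
        refine integral_mono_ae ?_ hIall hbd
        refine Integrable.of_bound (C := 1) ((hf.1.1.sub hcg.1.1).abs.aestronglyMeasurable) ?_
        refine Filter.Eventually.of_forall fun z => ?_
        have h1 := hf.2 z.1 z.2
        have h2 := hcg.2 z.1 z.2
        rw [Real.norm_eq_abs, abs_abs]
        exact abs_le.2 ⟨by linarith [h1.1, h2.2], by linarith [h1.2, h2.1]⟩
    _ = ∫ z, ‖Function.uncurry f z - φ z‖ ∂ρ + ε / 4 + 1 / p := by
        have e1 := integral_add (hI12.add (integrable_const (ε / 4))) hI3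
        have e2 := integral_add hI12 (integrable_const (ε / 4) : Integrable _ ρ)
        have e3 := integral_div (2:ℝ)
          (fun z : ℝ × ℝ => ‖Function.uncurry f z - φ z‖ + ‖Function.uncurry f z.swap - φ z.swap‖)
          (μ := ρ)
        have e4 := integral_add hI1 hI2
        simp only [Pi.add_apply] at e1 e2 e3 e4
        rw [e1, e2, e3, e4, hI2e, integral_indicator_const _ hD, integral_const, measureReal_def,
          measureReal_def, diag_measure]
        simp
    _ < ε := by linarith


/-! ### The forward direction -/

theorem extC_symm {p : ℕ} (c : Ed p → ℝ) (a b : Fin p) : extC c a b = extC c b a := by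
  unfold extC
  by_cases h : a = b
  · simp [h]
  · have h' : b ≠ a := fun hh => h hh.symm
    simp only [ne_eq, h, h', not_false_eq_true, dite_true, mkEd]
    congr 2
    exact Sym2.eq_swap

theorem extC_01 {p : ℕ} (c : Ed p → ℝ) (hc : ∀ i, c i ∈ Set.Icc (0:ℝ) 1) (a b : Fin p) :
    extC c a b ∈ Set.Icc (0:ℝ) 1 := by
  unfold extC
  split_ifs with h
  · exact hc _
  · simp

theorem extC_perm {p : ℕ} (c : Ed p → ℝ) (σ : Equiv.Perm (Fin p)) (a b : Fin p) :
    extC (fun z => c (edPerm σ z)) a b = extC c (σ a) (σ b) := by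
  unfold extC
  by_cases h : a = b
  · simp [h]
  · have h' : σ a ≠ σ b := fun hh => h (σ.injective hh)
    simp only [ne_eq, h, h', not_false_eq_true, dite_true]
    rw [edPerm_mk]

theorem hom_perm {p : ℕ} [NeZero p] (c : Ed p → ℝ) (σ : Equiv.Perm (Fin p)) (G : MG) :
    homDensity G (stepK (kap p) (extC (fun z => c (edPerm σ z))))
      = homDensity G (stepK (kap p) (extC c)) := by
  rw [homDensity_stepK _ (unif_kap p), homDensity_stepK _ (unif_kap p)]
  congr 1
  refine Fintype.sum_equiv (Equiv.arrowCongr (Equiv.refl _) σ) _ _ fun φ => ?_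
  refine Finset.prod_congr rfl fun e _ => ?_
  rw [extC_perm]
  rfl

theorem step_seg {p : ℕ} [NeZero p] (x y : Ed p → ℝ) (t : ℝ) :
    stepK (kap p) (extC (fun i => x i + t * (y i - x i)))
      = stepK (kap p) (extC x) + t • (stepK (kap p) (extC y) - stepK (kap p) (extC x)) := by
  funext u v
  simp only [stepK, Pi.add_apply, Pi.smul_apply, Pi.sub_apply, smul_eq_mul, extC]
  split_ifs <;> simp

theorem step_coeffs {N : ℕ} {F : Kern → ℝ} (hclass : IsClassFun F)
    (hseg : ∀ f ∈ Graphons, ∀ g ∈ Graphons, ∃ q : Polynomial ℝ, q.natDegree ≤ N ∧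
      ∀ t ∈ Set.Icc (0:ℝ) 1, F (f + t • (g - f)) = q.eval t) (p : ℕ) [NeZero p] (hp : 2 * N ≤ p) :
    ∃ a, GoodCoeffs N a ∧ ∀ c : Ed p → ℝ, (∀ i, c i ∈ Set.Icc (0:ℝ) 1) →
      F (stepK (kap p) (extC c)) = ∑ᶠ G : MG, a G * homDensity G (stepK (kap p) (extC c)) := by
  obtain ⟨P, hPd, hP⟩ := exists_mvpoly N (fun c : Ed p → ℝ => F (stepK (kap p) (extC c)))
    (fun x y hx hy => by
      obtain ⟨q, hq, hqe⟩ := hseg _ (extC_graphon x hx) _ (extC_graphon y hy)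
      refine ⟨q, hq, fun t ht => ?_⟩
      rw [← hqe t ht, step_seg])
  have hinv : InvP P := by
    intro σ
    rw [← sub_eq_zero]
    refine mvpoly_zero_of_cube _ fun c hc => ?_
    rw [map_sub, MvPolynomial.eval_rename, hP c hc]
    have hc' : ∀ i, (c ∘ edPerm σ) i ∈ Set.Icc (0:ℝ) 1 := fun i => hc _
    rw [hP _ hc', sub_eq_zero]
    exact hclass _ _ (extC_graphon _ hc') (extC_graphon _ hc) fun G _ => hom_perm c σ G
  obtain ⟨a, ha, haP⟩ := exists_coeffs_of_inv (NeZero.pos p) hp P hinv hPd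
  refine ⟨a, ha, fun c hc => ?_⟩
  rw [← eval_PhiP ha, haP, hP c hc]

theorem blowup (p k : ℕ) [NeZero p] [NeZero k] [NeZero (p * k)] (c : Ed p → ℝ)
    (hc : ∀ i, c i ∈ Set.Icc (0:ℝ) 1) : ∃ c' : Ed (p * k) → ℝ,
      (∀ i, c' i ∈ Set.Icc (0:ℝ) 1) ∧
      stepK (kap (p * k)) (extC c') = stepK (kap p) (extC c) := by
  let π : Fin (p * k) → Fin p := fun a => (finProdFinEquiv.symm a).1
  let c' : Ed (p * k) → ℝ := fun z =>
    Sym2.lift ⟨fun a b => extC c (π a) (π b), fun a b => extC_symm _ _ _⟩ z.1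
  have h1 : ∀ a b, extC c' a b = extC c (π a) (π b) := by
    intro a b
    by_cases h : a = b
    · simp [extC, h]
    · have : extC c' a b = c' (mkEd a b h) := by simp [extC, h]
      rw [this]
      rfl
  refine ⟨c', ?_, ?_⟩
  · rintro ⟨z, hz⟩
    induction z with
    | h a b => exact extC_01 c hc _ _
  · funext x y
    simp only [stepK, h1, π, kap_mul]

theorem sum_lip {N : ℕ} {a : MG → ℝ} (ha : GoodCoeffs N a) {f g : Kern} (hf : f ∈ Graphons)
    (hg : g ∈ Graphons) :
    |∑ᶠ G : MG, a G * homDensity G f - ∑ᶠ G : MG, a G * homDensity G g|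
      ≤ (∑ G ∈ goodFin N, |a G| * G.ne) * l1Dist f g := by
  rw [finsum_good ha, finsum_good ha, ← Finset.sum_sub_distrib, Finset.sum_mul]
  refine (Finset.abs_sum_le_sum_abs _ _).trans (Finset.sum_le_sum fun G _ => ?_)
  rw [← mul_sub, abs_mul, mul_assoc]
  exact mul_le_mul_of_nonneg_left (hom_lip G hf hg) (abs_nonneg _)

theorem GoodCoeffs.sub {N : ℕ} {a b : MG → ℝ} (ha : GoodCoeffs N a) (hb : GoodCoeffs N b) :
    GoodCoeffs N (a - b) := mem_goodV.1 ((goodV N).sub_mem (mem_goodV.2 ha) (mem_goodV.2 hb))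

theorem finsum_sub_good {N : ℕ} {a b : MG → ℝ} (ha : GoodCoeffs N a) (hb : GoodCoeffs N b)
    (u : MG → ℝ) : ∑ᶠ G : MG, (a - b) G * u G = ∑ᶠ G : MG, a G * u G - ∑ᶠ G : MG, b G * u G := by
  rw [finsum_good ha, finsum_good hb, finsum_good (ha.sub hb), ← Finset.sum_sub_distrib]
  refine Finset.sum_congr rfl fun G _ => ?_
  simp [sub_mul]

theorem coeffs_unique {N p : ℕ} [NeZero p] (hp : 2 * N ≤ p) {a b : MG → ℝ} (ha : GoodCoeffs N a)
    (hb : GoodCoeffs N b) (h : ∀ c : Ed p → ℝ, (∀ i, c i ∈ Set.Icc (0:ℝ) 1) →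
      ∑ᶠ G : MG, a G * homDensity G (stepK (kap p) (extC c))
        = ∑ᶠ G : MG, b G * homDensity G (stepK (kap p) (extC c))) : a = b := by
  rw [← sub_eq_zero]
  refine coeffs_zero hp (ha.sub hb) fun c hc => ?_
  rw [finsum_sub_good ha hb, h c hc, sub_self]

theorem forward {N : ℕ} {F : Kern → ℝ} (hclass : IsClassFun F) (hL1 : L1ContOn F)
    (hdiff : GDiffN Graphons F (N + 1))
    (hz : ∀ f ∈ Graphons, ∀ g : Fin (N + 1) → Kern, (∀ i, g i ∈ adm Graphons f) →
        gD Graphons F (N + 1) f g = 0) :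
    ∃ a : MG → ℝ, GoodCoeffs N a ∧
        ∀ f ∈ Graphons, F f = ∑ᶠ G : MG, a G * homDensity G f := by
  have hseg : ∀ f ∈ Graphons, ∀ g ∈ Graphons, ∃ q : Polynomial ℝ, q.natDegree ≤ N ∧
      ∀ t ∈ Set.Icc (0:ℝ) 1, F (f + t • (g - f)) = q.eval t :=
    fun f hf g hg => seg_poly hL1 hdiff hz hf hg
  obtain ⟨a, ha, hae⟩ := step_coeffs hclass hseg (2 * N + 1) (by omega)
  refine ⟨a, ha, fun f hf => ?_⟩
  by_contra hne
  set ε := |F f - ∑ᶠ G : MG, a G * homDensity G f| with hε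
  have hε0 : 0 < ε := abs_pos.2 (sub_ne_zero.2 hne)
  obtain ⟨δ, hδ, hδF⟩ := hL1 f hf (ε / 2) (by positivity)
  set L := ∑ G ∈ goodFin N, |a G| * G.ne with hL
  have hL0 : 0 ≤ L := Finset.sum_nonneg fun G _ => by positivity
  obtain ⟨k, hk, hkc⟩ := dense_step hf (2 * N + 1) (by omega)
    (ε := min δ (ε / 2 / (L + 1))) (lt_min hδ (by positivity))
  haveI : NeZero k := ⟨hk.ne'⟩
  haveI : NeZero ((2 * N + 1) * k) := ⟨by positivity⟩
  obtain ⟨c, hc, hcd⟩ := hkc inferInstance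
  obtain ⟨b, hb, hbe⟩ := step_coeffs hclass hseg ((2 * N + 1) * k)
    (le_trans (by omega) (Nat.le_mul_of_pos_right _ hk))
  have hab : a = b := by
    refine coeffs_unique (p := 2 * N + 1) (by omega) ha hb fun c hc => ?_
    obtain ⟨c', hc', hcc⟩ := blowup (2 * N + 1) k c hc
    rw [← hae c hc, ← hcc, hbe c' hc']
  have hcg := extC_graphon c hc
  have h1 := hδF _ hcg (lt_of_lt_of_le hcd (min_le_left _ _))
  have h2 := sum_lip ha hf hcg
  rw [← hL] at h2
  have h3 : L * l1Dist f (stepK (kap ((2 * N + 1) * k)) (extC c)) ≤ ε / 2 := by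
    have h4 := (lt_of_lt_of_le hcd (min_le_right _ _)).le
    calc _ ≤ L * (ε / 2 / (L + 1)) := mul_le_mul_of_nonneg_left h4 hL0
      _ = (ε / 2) * (L / (L + 1)) := by ring
      _ ≤ (ε / 2) * 1 := by
        refine mul_le_mul_of_nonneg_left ?_ (by positivity)
        rw [div_le_one (by positivity)]
        linarith
      _ = ε / 2 := mul_one _
  rw [hbe c hc, ← hab] at h1
  have h5 := abs_sub_le (F f) (∑ᶠ G : MG, a G *
    homDensity G (stepK (kap ((2 * N + 1) * k)) (extC c))) (∑ᶠ G : MG, a G * homDensity G f)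
  rw [abs_sub_comm] at h2
  linarith


/-! ### The backward direction -/

theorem hasDerivAt_eval {m : ℕ} (lam : Fin m → ℝ) (i : Fin m) (Q : MvPolynomial (Fin m) ℝ) :
    HasDerivAt (fun t : ℝ => MvPolynomial.eval (lam + t • (Pi.single i 1 : Fin m → ℝ)) Q)
      (MvPolynomial.eval lam (MvPolynomial.pderiv i Q)) 0 := by
  induction Q using MvPolynomial.induction_on with
  | C r => simpa using hasDerivAt_const (0:ℝ) r
  | add p q hp hq =>
    have := hp.add hq
    simp only [map_add]
    exact this
  | mul_X p j hp =>
    have hX : HasDerivAt (fun t : ℝ => (lam + t • (Pi.single i 1 : Fin m → ℝ)) j)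
        ((Pi.single i 1 : Fin m → ℝ) j) 0 := by
      simp only [Pi.add_apply, Pi.smul_apply, smul_eq_mul]
      have := ((hasDerivAt_id (0:ℝ)).mul_const ((Pi.single i 1 : Fin m → ℝ) j)).const_add (lam j)
      simpa using this
    have := hp.mul hX
    simp only [map_mul, MvPolynomial.eval_X]
    refine this.congr_deriv ?_
    rw [Derivation.leibniz]
    simp only [MvPolynomial.pderiv_X, map_add, smul_eq_mul, map_mul, MvPolynomial.eval_X, zero_smul,
      add_zero]
    have e : MvPolynomial.eval lam ((Pi.single i 1 : Fin m → MvPolynomial (Fin m) ℝ) j)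
        = (Pi.single i 1 : Fin m → ℝ) j := by
      by_cases h : j = i
      · subst h; simp
      · simp [h]
    rw [e]
    ring

theorem pderiv_td {m k : ℕ} (i : Fin m) (Q : MvPolynomial (Fin m) ℝ) (hQ : Q.totalDegree ≤ k + 1) :
    (MvPolynomial.pderiv i Q).totalDegree ≤ k := by
  rw [MvPolynomial.as_sum Q, map_sum]
  refine MvPolynomial.totalDegree_finsetSum_le fun d hd => ?_
  rw [MvPolynomial.pderiv_monomial]
  by_cases h0 : d i = 0
  · simp [h0]
  · refine (MvPolynomial.totalDegree_monomial_le _ _).trans ?_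
    have h1 : d.degree ≤ k + 1 := by
      refine le_trans ?_ hQ
      have := MvPolynomial.le_totalDegree hd
      rw [Finsupp.degree_apply]
      exact this
    have h2 : (d - Finsupp.single i 1) + Finsupp.single i 1 = d := by
      refine tsub_add_cancel_of_le ?_
      rw [Finsupp.single_le_iff]
      omega
    have h3 : (d - Finsupp.single i 1).degree + 1 = d.degree := by
      conv_rhs => rw [← h2]
      rw [map_add, Finsupp.degree_single]
    have h4 : (d - Finsupp.single i 1).degree ≤ k := by omega
    rw [Finsupp.degree_apply] at h4
    exact h4

/-- Iterated partial derivative `∂_{n-1} ⋯ ∂_0 P`. -/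
noncomputable def DnP {m : ℕ} (P : MvPolynomial (Fin m) ℝ) : ℕ → MvPolynomial (Fin m) ℝ
  | 0 => P
  | n + 1 => if h : n < m then MvPolynomial.pderiv ⟨n, h⟩ (DnP P n) else 0

theorem DnP_td {m N : ℕ} (P : MvPolynomial (Fin m) ℝ) (hP : P.totalDegree ≤ N) :
    ∀ n ≤ N, (DnP P n).totalDegree ≤ N - n := by
  intro n
  induction n with
  | zero => intro _; simpa [DnP] using hP
  | succ n ih =>
    intro hn
    simp only [DnP]
    split_ifs with h
    · exact pderiv_td _ _ ((ih (by omega)).trans (by omega))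
    · simp

theorem DnP_zero {m N : ℕ} (P : MvPolynomial (Fin m) ℝ) (hP : P.totalDegree ≤ N) :
    DnP P (N + 1) = 0 := by
  have h := DnP_td P hP N le_rfl
  rw [Nat.sub_self, Nat.le_zero] at h
  simp only [DnP]
  split_ifs with h1
  · rw [MvPolynomial.totalDegree_eq_zero_iff_eq_C.1 h, MvPolynomial.pderiv_C]
  · rfl

theorem gD_eval {m : ℕ} {U : Set Kern} {F : Kern → ℝ} (hdiff : GDiffN U F m) (f0 : Kern)
    (g : Fin m → Kern) {δ : ℝ}
    (hmem : ∀ lam : Fin m → ℝ, (∀ i, lam i ∈ Set.Ico 0 δ) → f0 + ∑ i, lam i • g i ∈ U)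
    (P : MvPolynomial (Fin m) ℝ)
    (hP : ∀ lam : Fin m → ℝ, (∀ i, lam i ∈ Set.Ico 0 δ) →
      F (f0 + ∑ i, lam i • g i) = MvPolynomial.eval lam P) :
    ∀ n, ∀ hn : n ≤ m, ∀ lam : Fin m → ℝ, (∀ i, lam i ∈ Set.Ico 0 δ) →
      gD U F n (f0 + ∑ i, lam i • g i) (fun i => g (Fin.castLE hn i))
        = MvPolynomial.eval lam (DnP P n) := by
  have hshift : ∀ (lam : Fin m → ℝ) (i : Fin m) (t : ℝ),
      f0 + ∑ j, lam j • g j + t • g i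
        = f0 + ∑ j, (lam + t • (Pi.single i 1 : Fin m → ℝ)) j • g j := by
    intro lam i t
    rw [add_assoc]
    congr 1
    simp only [Pi.add_apply, Pi.smul_apply, smul_eq_mul, add_smul, Finset.sum_add_distrib]
    congr 1
    rw [Finset.sum_eq_single i]
    · simp
    · intro j _ hj
      simp [hj]
    · simp
  have hbox : ∀ (lam : Fin m → ℝ), (∀ i, lam i ∈ Set.Ico 0 δ) → ∀ (i : Fin m) (t : ℝ), 0 ≤ t →
      t < δ - lam i → ∀ j, (lam + t • (Pi.single i 1 : Fin m → ℝ)) j ∈ Set.Ico 0 δ := by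
    intro lam hl i t ht0 ht j
    by_cases h : j = i
    · subst h
      simp only [Pi.add_apply, Pi.smul_apply, Pi.single_eq_same, smul_eq_mul, mul_one]
      exact ⟨by linarith [(hl j).1], by linarith⟩
    · simpa [h] using hl j
  intro n
  induction n with
  | zero =>
    intro hn lam hl
    simp only [gD, DnP]
    exact hP lam hl
  | succ n ih =>
    intro hn lam hl
    have hnm : n < m := hn
    set i : Fin m := ⟨n, hnm⟩ with hi
    have hadm : ∀ j : Fin m, g j ∈ adm U (f0 + ∑ i, lam i • g i) := by
      intro j
      refine ⟨min 1 (δ - lam j), lt_min zero_lt_one (by linarith [(hl j).2]), min_le_left _ _,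
        fun ε h0 h1 => ?_⟩
      rw [hshift]
      exact hmem _ (hbox lam hl j ε h0 (lt_of_lt_of_le h1 (min_le_right _ _)))
    have ht := hdiff.tend hnm (f0 + ∑ i, lam i • g i) (hmem lam hl)
      (fun j => g (Fin.castLE hn j)) (fun j => hadm _)
    have hlast : Fin.castLE hn (Fin.last n) = i := rfl
    simp only [hlast] at ht
    have hIoo : Set.Ioo (0:ℝ) (δ - lam i) ∈ 𝓝[>] (0:ℝ) :=
      Ioo_mem_nhdsGT (by linarith [(hl i).2])
    have hset : {t : ℝ | t ≠ 0 ∧ f0 + ∑ i, lam i • g i + t • g i ∈ U} ∈ 𝓝[>] (0:ℝ) := by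
      filter_upwards [hIoo] with t ht
      refine ⟨ht.1.ne', ?_⟩
      rw [hshift]
      exact hmem _ (hbox lam hl i t ht.1.le ht.2)
    have ht2 := ht.mono_left (nhdsWithin_le_of_mem hset)
    have ht3 := (hasDerivAt_iff_tendsto_slope_zero.1 (hasDerivAt_eval lam i (DnP P n))).mono_left
      (nhdsWithin_mono (0:ℝ) (show Set.Ioi (0:ℝ) ⊆ {0}ᶜ from fun t ht => (ne_of_gt ht : t ≠ 0)))
    have ht4 := tendsto_nhds_unique (ht2.congr' ?_) ht3
    · rw [ht4]
      simp only [DnP, hnm, dite_true, hi]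
    · filter_upwards [hIoo] with t ht
      have h1 := ih (Nat.le_of_succ_le hn) _ (hbox lam hl i t ht.1.le ht.2)
      have h2 := ih (Nat.le_of_succ_le hn) lam hl
      simp only [zero_add, zero_smul, add_zero]
      rw [← h1, ← h2, ← hshift, smul_eq_mul, div_eq_inv_mul]
      rfl

theorem hom_poly (G : MG) {m : ℕ} (h : Option (Fin m) → Kern)
    (hm : ∀ o, Measurable (Function.uncurry (h o))) {C : ℝ} (hC : ∀ o x y, |h o x y| ≤ C) :
    ∃ P : MvPolynomial (Fin m) ℝ, P.totalDegree ≤ G.ne ∧ ∀ lam : Fin m → ℝ,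
      homDensity G (h none + ∑ i, lam i • h (some i)) = MvPolynomial.eval lam P := by
  let XX : Option (Fin m) → MvPolynomial (Fin m) ℝ := fun o => o.elim 1 MvPolynomial.X
  refine ⟨∑ τ : Fin G.ne → Option (Fin m), (∏ e, XX (τ e)) * MvPolynomial.C
    (∫ x : Fin G.nv → ℝ, ∏ e : Fin G.ne, h (τ e) (x (G.s e)) (x (G.t e))
      ∂(Measure.pi fun _ => μ01)), ?_, ?_⟩
  · refine MvPolynomial.totalDegree_finsetSum_le fun τ _ => ?_
    refine (MvPolynomial.totalDegree_mul _ _).trans ?_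
    rw [MvPolynomial.totalDegree_C, add_zero]
    refine (MvPolynomial.totalDegree_finsetProd _ _).trans ?_
    calc _ ≤ ∑ e : Fin G.ne, 1 := by
          refine Finset.sum_le_sum fun e _ => ?_
          simp only [XX]
          cases τ e with
          | none => simp
          | some i => simp [MvPolynomial.totalDegree_X]
      _ = G.ne := by simp
  · intro lam
    have hC0 : 0 ≤ C := (abs_nonneg _).trans (hC none 0 0)
    have hInt : ∀ τ : Fin G.ne → Option (Fin m), Integrable (fun x : Fin G.nv → ℝ =>
        ∏ e : Fin G.ne, h (τ e) (x (G.s e)) (x (G.t e))) (Measure.pi fun _ => μ01) := by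
      intro τ
      refine Integrable.of_bound (C := ∏ e : Fin G.ne, C) (Measurable.aestronglyMeasurable
        (Finset.measurable_prod _ fun e _ => hom_measurable (hm _) _ _)) ?_
      refine Filter.Eventually.of_forall fun z => ?_
      rw [Real.norm_eq_abs, Finset.abs_prod]
      exact Finset.prod_le_prod (fun _ _ => abs_nonneg _) (fun e _ => hC _ _ _)
    rw [map_sum]
    simp only [map_mul, map_prod, MvPolynomial.eval_C]
    unfold homDensity
    have e1 : ∀ x : Fin G.nv → ℝ,
        ∏ e : Fin G.ne, (h none + ∑ i, lam i • h (some i)) (x (G.s e)) (x (G.t e))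
          = ∑ τ : Fin G.ne → Option (Fin m), (∏ e, MvPolynomial.eval lam (XX (τ e))) *
            ∏ e : Fin G.ne, h (τ e) (x (G.s e)) (x (G.t e)) := by
      intro x
      have e2 : ∀ e : Fin G.ne, (h none + ∑ i, lam i • h (some i)) (x (G.s e)) (x (G.t e))
          = ∑ o : Option (Fin m), MvPolynomial.eval lam (XX o) * h o (x (G.s e)) (x (G.t e)) := by
        intro e
        rw [Fintype.sum_option]
        simp [XX, Finset.sum_apply]
      rw [Finset.prod_congr rfl fun e _ => e2 e, Finset.prod_univ_sum, Fintype.piFinset_univ]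
      refine Finset.sum_congr rfl fun τ _ => ?_
      rw [Finset.prod_mul_distrib]
    simp only [e1]
    rw [integral_finsetSum _ fun τ _ => (hInt τ).const_mul _]
    refine Finset.sum_congr rfl fun τ _ => ?_
    rw [integral_const_mul]

theorem adm_kernel {f g : Kern} (hf : f ∈ Graphons) (hg : g ∈ adm Graphons f) :
    Measurable (Function.uncurry g) ∧ ∃ C, ∀ x y, |g x y| ≤ C := by
  obtain ⟨ε₀, h0, h1, h⟩ := hg
  have hh := h (ε₀ / 2) (by positivity) (by linarith)
  have e : ∀ x y, g x y = (2 / ε₀) * ((f + (ε₀ / 2) • g) x y - f x y) := by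
    intro x y
    simp only [Pi.add_apply, Pi.smul_apply, smul_eq_mul]
    field_simp
    ring
  constructor
  · have := (hh.1.1.sub hf.1.1).const_mul (2 / ε₀)
    convert this using 1
    funext z
    exact e z.1 z.2
  · refine ⟨2 / ε₀, fun x y => ?_⟩
    rw [e, abs_mul, abs_of_pos (by positivity)]
    refine mul_le_of_le_one_right (by positivity) ?_
    have h1 := hf.2 x y
    have h2 := hh.2 x y
    exact abs_le.2 ⟨by linarith [h1.2, h2.1], by linarith [h1.1, h2.2]⟩

theorem adm_box {m : ℕ} {f : Kern} {g : Fin (m + 1) → Kern}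
    (hg : ∀ i, g i ∈ adm Graphons f) : ∃ δ : ℝ, 0 < δ ∧
      ∀ lam : Fin (m + 1) → ℝ, (∀ i, lam i ∈ Set.Ico 0 δ) → f + ∑ i, lam i • g i ∈ Graphons := by
  choose ε h0 h1 h using hg
  obtain ⟨i0, -, hi0⟩ := Finset.exists_min_image Finset.univ ε ⟨0, Finset.mem_univ _⟩
  refine ⟨ε i0 / (m + 1), div_pos (h0 _) (by positivity), fun lam hl => ?_⟩
  have hm : ((m:ℝ) + 1) ≠ 0 := by positivity
  have e : f + ∑ i, lam i • g i
      = ∑ i : Fin (m + 1), ((m:ℝ) + 1)⁻¹ • (f + (((m:ℝ) + 1) * lam i) • g i) := by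
    simp only [smul_add, Finset.sum_add_distrib, Finset.sum_const, Finset.card_univ,
      Fintype.card_fin, smul_smul]
    congr 1
    · rw [← Nat.cast_smul_eq_nsmul ℝ, smul_smul]
      push_cast
      rw [mul_inv_cancel₀ hm, one_smul]
    · refine Finset.sum_congr rfl fun i _ => ?_
      rw [inv_mul_cancel_left₀ hm]
  rw [e]
  refine convex_graphons.sum_mem (fun i _ => by positivity) ?_ fun i _ => ?_
  · simp [hm]
  · refine h i _ (mul_nonneg (by positivity) (hl i).1) ?_
    have := (hl i).2
    rw [lt_div_iff₀ (by positivity)] at this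
    have := hi0 i (Finset.mem_univ _)
    linarith

theorem backward {N : ℕ} {F : Kern → ℝ} (hdiff : GDiffN Graphons F (N + 1))
    {a : MG → ℝ} (ha : GoodCoeffs N a)
    (hF : ∀ f ∈ Graphons, F f = ∑ᶠ G : MG, a G * homDensity G f) :
    ∀ f ∈ Graphons, ∀ g : Fin (N + 1) → Kern, (∀ i, g i ∈ adm Graphons f) →
        gD Graphons F (N + 1) f g = 0 := by
  intro f hf g hg
  obtain ⟨δ, hδ, hmem⟩ := adm_box hg
  choose C hC using fun i => (adm_kernel hf (hg i)).2
  let h : Option (Fin (N + 1)) → Kern := fun o => o.elim f g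
  have hm : ∀ o, Measurable (Function.uncurry (h o)) := by
    intro o
    cases o with
    | none => exact hf.1.1
    | some i => exact (adm_kernel hf (hg i)).1
  have hbd : ∀ o x y, |h o x y| ≤ 1 + ∑ i, |C i| := by
    intro o x y
    have hs : 0 ≤ ∑ i, |C i| := Finset.sum_nonneg fun i _ => abs_nonneg _
    cases o with
    | none =>
      have h1 := hf.2 x y
      have : |f x y| ≤ 1 := abs_le.2 ⟨by linarith [h1.1], h1.2⟩
      simp only [h, Option.elim]
      linarith
    | some i =>
      have h1 := hC i x y
      have h2 := le_abs_self (C i)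
      have h3 := Finset.single_le_sum (f := fun i => |C i|) (fun i _ => abs_nonneg _)
        (Finset.mem_univ i)
      simp only [h, Option.elim]
      linarith
  choose P hPd hPe using fun G : MG => hom_poly G h hm hbd
  let Q : MvPolynomial (Fin (N + 1)) ℝ := ∑ G ∈ goodFin N, a G • P G
  have hQd : Q.totalDegree ≤ N := by
    refine MvPolynomial.totalDegree_finsetSum_le fun G hG => ?_
    exact (MvPolynomial.totalDegree_smul_le _ _).trans ((hPd G).trans (mem_goodFin.1 hG).1)
  have hQe : ∀ lam : Fin (N + 1) → ℝ, (∀ i, lam i ∈ Set.Ico 0 δ) →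
      F (f + ∑ i, lam i • g i) = MvPolynomial.eval lam Q := by
    intro lam hl
    rw [hF _ (hmem lam hl), finsum_good ha, map_sum]
    refine Finset.sum_congr rfl fun G _ => ?_
    rw [MvPolynomial.smul_eval, ← hPe]
    rfl
  have := gD_eval hdiff f g hmem Q hQe (N + 1) le_rfl 0 (fun i => by simpa using hδ)
  rw [DnP_zero Q hQd] at this
  simpa using this


/-! ### Cut-norm continuity -/

theorem exists_kappa (p n : ℕ) [NeZero p] : ∃ κ : ℝ → Fin p × (Fin n → Bool),
    UnifMap κ ∧ ∀ x, (κ x).1 = kap p x := by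
  have h1 : NeZero (2 ^ n) := ⟨by positivity⟩
  have h2 : NeZero (p * 2 ^ n) := ⟨mul_ne_zero (NeZero.ne p) (NeZero.ne _)⟩
  let e : Fin (2 ^ n) ≃ (Fin n → Bool) := (Fintype.equivFinOfCardEq (by simp)).symm
  let e' : Fin (p * 2 ^ n) ≃ Fin p × (Fin n → Bool) :=
    finProdFinEquiv.symm.trans (Equiv.prodCongr (Equiv.refl _) e)
  refine ⟨fun x => e' (kap (p * 2 ^ n) x), unif_equiv _ (unif_kap _) e', fun x => ?_⟩
  exact kap_mul p (2 ^ n) x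

/-- The sign of a boolean. -/
def sgn (b : Bool) : ℝ := if b then -1 else 1

theorem sgn_pm (b : Bool) : sgn b = 1 ∨ sgn b = -1 := by
  cases b <;> simp [sgn]

/-- The Hadamard (Walsh) matrix. -/
def chi {n : ℕ} (k l : Fin n → Bool) : ℝ := ∏ i, sgn (k i && l i)

theorem prod_pm {ι : Type} (s : Finset ι) (u : ι → ℝ) (h : ∀ i, u i = 1 ∨ u i = -1) :
    ∏ i ∈ s, u i = 1 ∨ ∏ i ∈ s, u i = -1 := by
  induction s using Finset.induction_on with
  | empty => simp
  | insert i s hi ih =>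
    rw [Finset.prod_insert hi]
    rcases h i with h1 | h1 <;> rcases ih with h2 | h2 <;> simp [h1, h2]

theorem chi_pm {n : ℕ} (k l : Fin n → Bool) : chi k l = 1 ∨ chi k l = -1 :=
  prod_pm _ _ fun _ => sgn_pm _

theorem chi_symm {n : ℕ} (k l : Fin n → Bool) : chi k l = chi l k := by
  simp only [chi, Bool.and_comm]

theorem chi_orth {n : ℕ} (l l' : Fin n → Bool) :
    ∑ k, chi k l * chi k l' = if l = l' then (2:ℝ) ^ n else 0 := by
  have h1 : ∀ k : Fin n → Bool, chi k l * chi k l'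
      = ∏ i, (fun i b => sgn (b && l i) * sgn (b && l' i)) i (k i) := by
    intro k
    simp only [chi, Finset.prod_mul_distrib]
  rw [Finset.sum_congr rfl fun k _ => h1 k, ← Fintype.piFinset_univ,
    ← Finset.prod_univ_sum (fun _ => Finset.univ)
      (fun i b => sgn (b && l i) * sgn (b && l' i))]
  have h2 : ∀ i, ∑ b, sgn (b && l i) * sgn (b && l' i) = if l i = l' i then (2:ℝ) else 0 := by
    intro i
    rw [Fintype.sum_bool]
    cases l i <;> cases l' i <;> norm_num [sgn]
  rw [Finset.prod_congr rfl fun i _ => h2 i]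
  split_ifs with h
  · subst h; simp
  · obtain ⟨i, hi⟩ := Function.ne_iff.1 h
    exact Finset.prod_eq_zero (Finset.mem_univ i) (if_neg hi)

theorem chi_bilin {n : ℕ} (u w : (Fin n → Bool) → ℝ) {r : ℝ}
    (hu : ∀ k, |u k| ≤ r) (hw : ∀ k, |w k| ≤ r) :
    (∑ k, ∑ l, u k * (chi k l * w l)) ^ 2 ≤ (2:ℝ) ^ n * (2 ^ n * r ^ 2) ^ 2 := by
  have h1 : ∑ k, ∑ l, u k * (chi k l * w l) = ∑ k, u k * ∑ l, chi k l * w l := by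
    simp only [Finset.mul_sum]
  rw [h1]
  refine (Finset.sum_mul_sq_le_sq_mul_sq _ _ _).trans ?_
  have hsq : ∀ v : (Fin n → Bool) → ℝ, (∀ k, |v k| ≤ r) → ∑ k, v k ^ 2 ≤ 2 ^ n * r ^ 2 := by
    intro v hv
    calc ∑ k, v k ^ 2 ≤ ∑ k : Fin n → Bool, r ^ 2 := Finset.sum_le_sum fun k _ =>
          sq_le_sq.2 ((hv k).trans (le_abs_self r))
      _ = 2 ^ n * r ^ 2 := by simp
  have h2 : ∑ k, (∑ l, chi k l * w l) ^ 2 = 2 ^ n * ∑ l, w l ^ 2 := by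
    calc ∑ k, (∑ l, chi k l * w l) ^ 2
        = ∑ k, ∑ l, ∑ l', w l * w l' * (chi k l * chi k l') := by
          refine Finset.sum_congr rfl fun k _ => ?_
          rw [sq, Finset.sum_mul_sum]
          refine Finset.sum_congr rfl fun l _ => Finset.sum_congr rfl fun l' _ => ?_
          ring
      _ = ∑ l, ∑ l', w l * w l' * ∑ k, chi k l * chi k l' := by
          rw [Finset.sum_comm]
          refine Finset.sum_congr rfl fun l _ => ?_
          rw [Finset.sum_comm]
          simp only [Finset.mul_sum]
      _ = 2 ^ n * ∑ l, w l ^ 2 := by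
          rw [Finset.mul_sum]
          refine Finset.sum_congr rfl fun l _ => ?_
          simp only [chi_orth]
          simp
          ring
  rw [h2]
  have h3 := hsq u hu
  have h4 := hsq w hw
  have h5 : 0 ≤ ∑ k, u k ^ 2 := Finset.sum_nonneg fun _ _ => sq_nonneg _
  calc (∑ k, u k ^ 2) * (2 ^ n * ∑ l, w l ^ 2)
      ≤ (2 ^ n * r ^ 2) * (2 ^ n * (2 ^ n * r ^ 2)) := by gcongr
    _ = _ := by ring

theorem int_step {ι : Type} [Fintype ι] [MeasurableSpace ι] [MeasurableSingletonClass ι]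
    {κ : ℝ → ι} (hκ : Measurable κ) {S : Set ℝ} (hS1 : S ⊆ Set.Icc 0 1) (h : ι → ℝ) :
    ∫ x in S, h (κ x) = ∑ u, (volume.restrict S).real (κ ⁻¹' {u}) * h u := by
  have hfin : IsFiniteMeasure (volume.restrict S) :=
    ⟨by rw [Measure.restrict_apply_univ]
        exact lt_of_le_of_lt (measure_mono hS1) (by simp)⟩
  have hm : Measurable h := measurable_of_finite h
  have h1 := integral_map (μ := volume.restrict S) hκ.aemeasurable
    (f := h) hm.aestronglyMeasurable
  rw [← h1, integral_fintype (.of_finite)]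
  refine Finset.sum_congr rfl fun u _ => ?_
  rw [smul_eq_mul, map_measureReal_apply hκ (measurableSet_singleton _)]

theorem mass_le {ι : Type} [Fintype ι] [MeasurableSpace ι] [MeasurableSingletonClass ι]
    {κ : ℝ → ι} (hκ : UnifMap κ) {S : Set ℝ} (hS1 : S ⊆ Set.Icc 0 1) (u : ι) :
    |(volume.restrict S).real (κ ⁻¹' {u})| ≤ (Fintype.card ι : ℝ)⁻¹ := by
  rw [abs_of_nonneg measureReal_nonneg]
  have h1 : (volume.restrict S) (κ ⁻¹' {u}) ≤ (Fintype.card ι : ℝ≥0∞)⁻¹ := by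
    rw [← hκ.2 u]
    exact Measure.restrict_mono hS1 le_rfl _
  have h2 : ((Fintype.card ι : ℝ≥0∞)⁻¹) ≠ ⊤ := by
    rw [← hκ.2 u]
    exact measure_ne_top _ _
  have := ENNReal.toReal_mono h2 h1
  simpa [measureReal_def] using this

theorem cut_small (p n : ℕ) [NeZero p] {κ : ℝ → Fin p × (Fin n → Bool)} (hκ : UnifMap κ)
    (d : Fin p → Fin p → ℝ) (hd : ∀ a b, |d a b| ≤ 1) :
    cutNorm (stepK κ (fun u v => d u.1 v.1 * chi u.2 v.2)) ≤ p ^ 2 * √((2:ℝ)⁻¹ ^ n) := by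
  refine Real.sSup_le ?_ (by positivity)
  rintro r ⟨S, T, hS, hT, hS1, hT1, rfl⟩
  let μS : Fin p × (Fin n → Bool) → ℝ := fun u => (volume.restrict S).real (κ ⁻¹' {u})
  let μT : Fin p × (Fin n → Bool) → ℝ := fun u => (volume.restrict T).real (κ ⁻¹' {u})
  have hp1 : (1:ℝ) ≤ p := by exact_mod_cast NeZero.pos p
  have hcard : (Fintype.card (Fin p × (Fin n → Bool)) : ℝ)⁻¹ ≤ (2:ℝ)⁻¹ ^ n := by
    rw [inv_pow]
    refine inv_anti₀ (by positivity) ?_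
    simp only [Fintype.card_prod, Fintype.card_fin, Fintype.card_pi, Fintype.card_bool,
      Finset.prod_const, Finset.card_univ]
    push_cast
    nlinarith [show (0:ℝ) < 2 ^ n by positivity]
  have hμS : ∀ u, |μS u| ≤ (2:ℝ)⁻¹ ^ n := fun u => (mass_le hκ hS1 u).trans hcard
  have hμT : ∀ u, |μT u| ≤ (2:ℝ)⁻¹ ^ n := fun u => (mass_le hκ hT1 u).trans hcard
  have e1 : ∫ x in S, ∫ y in T, stepK κ (fun u v => d u.1 v.1 * chi u.2 v.2) x y
      = ∑ u, μS u * ∑ v, μT v * (d u.1 v.1 * chi u.2 v.2) := by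
    rw [← int_step hκ.1 hS1 (fun u => ∑ v, μT v * (d u.1 v.1 * chi u.2 v.2))]
    congr 1
    funext x
    exact int_step hκ.1 hT1 (fun v => d (κ x).1 v.1 * chi (κ x).2 v.2)
  have e2 : ∑ u, μS u * ∑ v, μT v * (d u.1 v.1 * chi u.2 v.2)
      = ∑ i, ∑ j, d i j * ∑ k, ∑ l, μS (i, k) * (chi k l * μT (j, l)) := by
    simp only [Fintype.sum_prod_type, Finset.mul_sum]
    refine Finset.sum_congr rfl fun i _ => ?_
    rw [Finset.sum_comm]
    refine Finset.sum_congr rfl fun j _ => Finset.sum_congr rfl fun k _ =>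
      Finset.sum_congr rfl fun l _ => ?_
    ring
  rw [e1, e2]
  have h3 : ∀ i j, |∑ k, ∑ l, μS (i, k) * (chi k l * μT (j, l))| ≤ √((2:ℝ)⁻¹ ^ n) := by
    intro i j
    refine Real.abs_le_sqrt ?_
    refine (chi_bilin (fun k => μS (i, k)) (fun l => μT (j, l)) (fun k => hμS _)
      (fun l => hμT _)).trans (le_of_eq ?_)
    have : (2:ℝ) ^ n ≠ 0 := by positivity
    rw [inv_pow]
    field_simp
  calc |∑ i, ∑ j, d i j * ∑ k, ∑ l, μS (i, k) * (chi k l * μT (j, l))|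
      ≤ ∑ i : Fin p, ∑ j : Fin p, √((2:ℝ)⁻¹ ^ n) := by
        refine (Finset.abs_sum_le_sum_abs _ _).trans (Finset.sum_le_sum fun i _ => ?_)
        refine (Finset.abs_sum_le_sum_abs _ _).trans (Finset.sum_le_sum fun j _ => ?_)
        rw [abs_mul]
        calc _ ≤ 1 * √((2:ℝ)⁻¹ ^ n) :=
              mul_le_mul (hd i j) (h3 i j) (abs_nonneg _) zero_le_one
          _ = _ := one_mul _
    _ = p ^ 2 * √((2:ℝ)⁻¹ ^ n) := by
        simp only [Finset.sum_const, Finset.card_univ, Fintype.card_fin, nsmul_eq_mul]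
        ring

/-- The sign product of an edge set at a boolean vertex labelling. -/
def eprod (G : MG) (S : Finset (Fin G.ne)) (b : Fin G.nv → Bool) : ℝ :=
  ∏ e ∈ S, sgn (b (G.s e) && b (G.t e))

/-- The normalized character sum of an edge set. -/
noncomputable def gam (G : MG) (S : Finset (Fin G.ne)) : ℝ :=
  ((2:ℝ) ^ G.nv)⁻¹ * ∑ b : Fin G.nv → Bool, eprod G S b

/-- Number of edge subsets with trivial character. -/
noncomputable def kapG (G : MG) : ℕ :=
  (Finset.univ.filter fun S : Finset (Fin G.ne) => ∀ b, eprod G S b = 1).card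

theorem hom_chi (n : ℕ) (G : MG) :
    ((2:ℝ) ^ n)⁻¹ ^ G.nv * ∑ φ : Fin G.nv → (Fin n → Bool), ∏ e, (1 + chi (φ (G.s e)) (φ (G.t e)))
      = ∑ S : Finset (Fin G.ne), gam G S ^ n := by
  have h1 : ∀ φ : Fin G.nv → (Fin n → Bool), ∏ e, (1 + chi (φ (G.s e)) (φ (G.t e)))
      = ∑ S : Finset (Fin G.ne), ∏ i, eprod G S (fun v => φ v i) := by
    intro φ
    rw [Finset.prod_one_add, Finset.powerset_univ]
    refine Finset.sum_congr rfl fun S _ => ?_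
    simp only [chi, eprod]
    rw [Finset.prod_comm]
  rw [Finset.sum_congr rfl fun φ _ => h1 φ, Finset.sum_comm, Finset.mul_sum]
  refine Finset.sum_congr rfl fun S _ => ?_
  unfold gam
  rw [mul_pow, Fintype.sum_pow]
  congr 1
  · rw [inv_pow, inv_pow, ← pow_mul, ← pow_mul, mul_comm]
  · exact Fintype.sum_equiv (Equiv.piComm _) _ _ fun φ => rfl

theorem gam_tendsto (G : MG) (S : Finset (Fin G.ne)) :
    Tendsto (fun n : ℕ => gam G S ^ n) atTop (𝓝 (if ∀ b, eprod G S b = 1 then 1 else 0)) := by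
  have hpm : ∀ b, eprod G S b = 1 ∨ eprod G S b = -1 := fun b => prod_pm _ _ fun e => sgn_pm _
  have h2 : (0:ℝ) < 2 ^ G.nv := by positivity
  have hsum1 : ∑ b : Fin G.nv → Bool, (1:ℝ) = 2 ^ G.nv := by simp
  split_ifs with h
  · have : gam G S = 1 := by
      unfold gam
      simp only [h, hsum1]
      exact inv_mul_cancel₀ h2.ne'
    simp [this]
  · push Not at h
    obtain ⟨b1, hb1⟩ := h
    have hb1' := (hpm b1).resolve_left hb1
    apply tendsto_pow_atTop_nhds_zero_of_abs_lt_one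
    unfold gam
    rw [abs_mul, abs_of_pos (inv_pos.2 h2), inv_mul_lt_one₀ h2, abs_lt]
    constructor
    · rw [← hsum1, ← Finset.sum_neg_distrib]
      refine Finset.sum_lt_sum (fun b _ => ?_) ⟨fun _ => false, Finset.mem_univ _, ?_⟩
      · rcases hpm b with h | h <;> rw [h]; norm_num
      · have : eprod G S (fun _ => false) = 1 := by simp [eprod, sgn]
        rw [this]; norm_num
    · rw [← hsum1]
      refine Finset.sum_lt_sum (fun b _ => ?_) ⟨b1, Finset.mem_univ _, ?_⟩
      · rcases hpm b with h | h <;> rw [h]; norm_num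
      · rw [hb1']; norm_num

theorem gam_sum_tendsto (G : MG) :
    Tendsto (fun n : ℕ => ∑ S : Finset (Fin G.ne), gam G S ^ n) atTop (𝓝 (kapG G : ℝ)) := by
  have := tendsto_finsetSum Finset.univ fun S (_ : S ∈ Finset.univ) => gam_tendsto G S
  convert this using 2
  rw [Finset.sum_ite]
  simp [kapG]

theorem MGIso.ne_eq {G H : MG} (h : MGIso G H) : G.ne = H.ne := by
  obtain ⟨φ, hφ⟩ := h
  simpa using Fintype.card_of_bijective hφ.2

theorem kapG_le {G H : MG} (h : MGIso G H) : kapG G ≤ kapG H := by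
  obtain ⟨φ, hφ⟩ := h
  refine Finset.card_le_card_of_injOn (fun S => S.map ⟨φ.eMap, hφ.2.1⟩) ?_ ?_
  · intro S hS
    simp only [Finset.coe_filter, Finset.mem_univ, true_and, Set.mem_ofPred_eq] at hS ⊢
    intro b
    rw [← hS (fun v => b (φ.vMap v))]
    simp only [eprod, Finset.prod_map, Function.Embedding.coeFn_mk]
    refine Finset.prod_congr rfl fun e _ => ?_
    have h1 := MGIso.sym2 φ e
    rcases Sym2.eq_iff.1 h1 with ⟨h2, h3⟩ | ⟨h2, h3⟩
    · rw [h2, h3]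
    · rw [h2, h3, Bool.and_comm]
  · intro S _ T _ hST
    exact Finset.map_injective _ hST

theorem kapG_iso {G H : MG} (h : MGIso G H) : kapG G = kapG H :=
  le_antisymm (kapG_le h) (kapG_le h.symm')

theorem kapG_two {G : MG} (h : ¬ IsSimpleMG G) : 2 ≤ kapG G := by
  unfold IsSimpleMG at h
  push Not at h
  obtain ⟨e, e', hee, hne⟩ := h
  have h1 : s(G.s e, G.t e) = s(G.s e', G.t e') := sym2_of_pair_eq (G.noLoop e) hee
  have hsub : ({∅, {e, e'}} : Finset (Finset (Fin G.ne))) ⊆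
      Finset.univ.filter fun S : Finset (Fin G.ne) => ∀ b, eprod G S b = 1 := by
    intro S hS
    simp only [Finset.mem_insert, Finset.mem_singleton] at hS
    simp only [Finset.mem_filter, Finset.mem_univ, true_and]
    intro b
    rcases hS with rfl | rfl
    · simp [eprod]
    · rw [eprod, Finset.prod_pair hne]
      have h3 : (b (G.s e) && b (G.t e)) = (b (G.s e') && b (G.t e')) := by
        rcases Sym2.eq_iff.1 h1 with ⟨h2, h3⟩ | ⟨h2, h3⟩
        · rw [h2, h3]
        · rw [h2, h3, Bool.and_comm]
      rw [h3]
      rcases sgn_pm (b (G.s e') && b (G.t e')) with h | h <;> rw [h] <;> norm_num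
  have h2 : ({∅, {e, e'}} : Finset (Finset (Fin G.ne))).card = 2 := by
    refine Finset.card_pair ?_
    intro hh
    have : e ∈ (∅ : Finset (Fin G.ne)) := by rw [hh]; simp
    simp at this
  rw [← h2]
  exact Finset.card_le_card hsub

theorem cut_part {N : ℕ} {F : Kern → ℝ} (hcut : CutContOn F)
    {a : MG → ℝ} (ha : GoodCoeffs N a)
    (hF : ∀ f ∈ Graphons, F f = ∑ᶠ G : MG, a G * homDensity G f) :
    ∀ G : MG, ¬ IsSimpleMG G → a G = 0 := by
  let b : MG → ℝ := fun G => a G * ((kapG G : ℝ) - 1) * (2:ℝ)⁻¹ ^ G.ne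
  have hb : GoodCoeffs N b := by
    constructor
    · intro G H h
      simp only [b]
      rw [ha.1 G H h, kapG_iso h, h.ne_eq]
    · intro G h
      simp [b, ha.2 G h]
  have hb0 : b = 0 := by
    obtain ⟨p, hp⟩ : ∃ p, p = 2 * N + 1 := ⟨_, rfl⟩
    have : NeZero p := ⟨by omega⟩
    refine coeffs_zero (p := p) (by omega) hb fun c hc => ?_
    choose κ hκ hκ1 using fun n => exists_kappa p n
    let d : Fin p → Fin p → ℝ := fun i j => (2:ℝ)⁻¹ * extC c i j
    have hd01 : ∀ i j, 0 ≤ d i j ∧ d i j ≤ 2⁻¹ := fun i j => by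
      have := extC_01 c hc i j
      simp only [d]
      constructor
      · have := this.1; positivity
      · have := this.2; linarith
    have hds : ∀ i j, d i j = d j i := fun i j => by simp only [d, extC_symm c i j]
    let f : Kern := stepK (kap p) d
    let fn : ℕ → Kern := fun n => stepK (κ n) (fun u v => d u.1 v.1 * (1 + chi u.2 v.2))
    have hf : f ∈ Graphons := stepK_graphon _ (measurable_kap p) _ hds fun i j =>
      ⟨(hd01 i j).1, (hd01 i j).2.trans (by norm_num)⟩
    have hfn : ∀ n, fn n ∈ Graphons := by
      intro n
      refine stepK_graphon _ (hκ n).1 _ (fun u v => ?_) fun u v => ?_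
      · rw [hds, chi_symm]
      · have := hd01 u.1 v.1
        rcases chi_pm u.2 v.2 with h | h <;> rw [h] <;> constructor <;> linarith
    have hdiff : ∀ n, f - fn n = stepK (κ n) (fun u v => -d u.1 v.1 * chi u.2 v.2) := by
      intro n
      funext x y
      simp only [f, fn, Pi.sub_apply, stepK, hκ1]
      ring
    have hhf : ∀ G, homDensity G f
        = (2:ℝ)⁻¹ ^ G.ne * homDensity G (stepK (kap p) (extC c)) := by
      intro G
      simp only [f]
      rw [homDensity_stepK _ (unif_kap p), homDensity_stepK _ (unif_kap p), mul_left_comm]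
      congr 1
      rw [Finset.mul_sum]
      refine Finset.sum_congr rfl fun φ _ => ?_
      simp only [d]
      rw [Finset.prod_mul_distrib]
      simp
    have hhfn : ∀ n G, homDensity G (fn n)
        = homDensity G f * ∑ S : Finset (Fin G.ne), gam G S ^ n := by
      intro n G
      simp only [f, fn]
      rw [homDensity_stepK _ (hκ n), homDensity_stepK _ (unif_kap p), ← hom_chi]
      rw [mul_mul_mul_comm, ← mul_pow, Finset.sum_mul_sum]
      congr 1
      · congr 1
        simp
        ring
      · rw [← Fintype.sum_prod_type']
        refine Fintype.sum_equiv (Equiv.arrowProdEquivProdArrow _ _ _) _ _ fun φ => ?_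
        rw [Finset.prod_mul_distrib]
        rfl
    -- limits
    have hlim1 : Tendsto (fun n => F (fn n)) atTop (𝓝 (F f)) := by
      have hc0 : Tendsto (fun n : ℕ => (p:ℝ) ^ 2 * √((2:ℝ)⁻¹ ^ n)) atTop (𝓝 0) := by
        have h1 : Tendsto (fun n : ℕ => (2:ℝ)⁻¹ ^ n) atTop (𝓝 0) :=
          tendsto_pow_atTop_nhds_zero_of_lt_one (by norm_num) (by norm_num)
        have h2 := ((Real.continuous_sqrt.tendsto 0).comp h1).const_mul ((p:ℝ) ^ 2)
        simpa using h2
      rw [Metric.tendsto_nhds]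
      intro ε hε
      obtain ⟨δ, hδ, hδF⟩ := hcut f hf ε hε
      filter_upwards [hc0.eventually_lt_const hδ] with n hn
      rw [dist_comm, Real.dist_eq]
      refine hδF _ (hfn n) (lt_of_le_of_lt ?_ hn)
      rw [hdiff n]
      refine cut_small p n (hκ n) (fun i j => -d i j) fun i j => ?_
      rw [abs_neg, abs_of_nonneg (hd01 i j).1]
      exact (hd01 i j).2.trans (by norm_num)
    have hlim2 : Tendsto (fun n => F (fn n)) atTop
        (𝓝 (∑ G ∈ goodFin N, a G * (homDensity G f * (kapG G : ℝ)))) := by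
      have e : ∀ n, F (fn n) = ∑ G ∈ goodFin N, a G *
          (homDensity G f * ∑ S : Finset (Fin G.ne), gam G S ^ n) := by
        intro n
        rw [hF _ (hfn n), finsum_good ha]
        simp only [hhfn]
      simp only [e]
      exact tendsto_finsetSum _ fun G _ => ((gam_sum_tendsto G).const_mul _).const_mul _
    have heq := tendsto_nhds_unique hlim1 hlim2
    rw [hF f hf, finsum_good ha] at heq
    rw [finsum_good hb]
    have : ∑ G ∈ goodFin N, b G * homDensity G (stepK (kap p) (extC c))
        = ∑ G ∈ goodFin N, a G * (homDensity G f * (kapG G : ℝ))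
          - ∑ G ∈ goodFin N, a G * homDensity G f := by
      rw [← Finset.sum_sub_distrib]
      refine Finset.sum_congr rfl fun G _ => ?_
      simp only [b]
      rw [hhf]
      ring
    rw [this, heq, sub_self]
  intro G hG
  have h1 : b G = 0 := congrFun hb0 G
  have h2 : (2:ℝ) ≤ kapG G := by exact_mod_cast kapG_two hG
  simp only [b] at h1
  rcases mul_eq_zero.1 h1 with h3 | h3
  · rcases mul_eq_zero.1 h3 with h4 | h4
    · exact h4
    · linarith
  · exact absurd h3 (by positivity)


/-- Main theorem. Let `F : W → ℝ` be a class function, continuous in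
the `L¹` norm and `(N+1)` times Gâteaux differentiable. Then `d^{N+1}F ≡ 0` in all
admissible directions iff `F` is a (unique) linear combination of homomorphism
densities `t(H, ·)` over the isomorphism classes `H` of multigraphs with at most `N`
edges and no isolated vertices; and if `F` is moreover cut-norm continuous, the
coefficients of non-simple multigraphs vanish. -/
theorem stmt0 (N : ℕ) (F : Kern → ℝ) (hclass : IsClassFun F)
    (hL1 : L1ContOn F) (hdiff : GDiffN Graphons F (N + 1)) :
    ((∀ f ∈ Graphons, ∀ g : Fin (N + 1) → Kern, (∀ i, g i ∈ adm Graphons f) →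
        gD Graphons F (N + 1) f g = 0) ↔
      ∃ a : MG → ℝ, GoodCoeffs N a ∧
        ∀ f ∈ Graphons, F f = ∑ᶠ G : MG, a G * homDensity G f) ∧
    (∀ a a' : MG → ℝ, GoodCoeffs N a → GoodCoeffs N a' →
      (∀ f ∈ Graphons, F f = ∑ᶠ G : MG, a G * homDensity G f) →
      (∀ f ∈ Graphons, F f = ∑ᶠ G : MG, a' G * homDensity G f) → a = a') ∧
    (CutContOn F → ∀ a : MG → ℝ, GoodCoeffs N a →
      (∀ f ∈ Graphons, F f = ∑ᶠ G : MG, a G * homDensity G f) →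
      ∀ G : MG, ¬ IsSimpleMG G → a G = 0) := by
  refine ⟨⟨fun hz => forward hclass hL1 hdiff hz, fun ⟨a, ha, hF⟩ => backward hdiff ha hF⟩, ?_, ?_⟩
  · intro a a' ha ha' hF hF'
    refine coeffs_unique (p := 2 * N + 1) (by omega) ha ha' fun c hc => ?_
    rw [← hF _ (extC_graphon c hc), ← hF' _ (extC_graphon c hc)]
  · intro hcut a ha hF
    exact cut_part hcut ha hF
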